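/- Let N ≥ 3, α > 0, k = k(α) = (2N-2+α)/(2+α), and let F : ℝ → ℝ be continuously differentiable. Suppose V_α ∈ C²((0,∞)) is a positive solution of -V'' - (k/t)V' = F(V) on (0,∞) with lim_{t→0⁺} V_α'(t) = 0 and lim_{t→∞} V_α(t) = 0, that V_α has Morse index one, that V_α' ∈ E, that V_α is degenerate (the linearized ODE -ψ'' - (k/t)ψ' = F'(V_α)·ψ has a nontrivial solution ψ ∈ E), and that α = 2i for a positive integer i. Let u_α(x) = V_α((2/(2+α))|x|^{(2+α)/2}). Then the real vector space of solutions w of the linearized problem -Δw = |x|^α F'(u_α)·w on ℝ^N∖{0} with |x|^{α/2}w ∈ L²(ℝ^N) and |∇w| ∈ L²(ℝ^N) has dimension n_α + (N+2i)·(N+i-2)! / ((N-2)!·(i+1)!). -/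

import Mathlib

open MeasureTheory Filter Set Topology

/-- The Euclidean Laplacian: sum of second partial derivatives. -/
noncomputable def lap {N : ℕ} (u : EuclideanSpace ℝ (Fin N) → ℝ)
    (x : EuclideanSpace ℝ (Fin N)) : ℝ :=
  ∑ i : Fin N, fderiv ℝ (fun y => fderiv ℝ u y (EuclideanSpace.single i 1)) x
    (EuclideanSpace.single i 1)

/-- k(α) = (2N-2+α)/(2+α). -/
noncomputable def kk (N : ℕ) (α : ℝ) : ℝ := (2 * (N : ℝ) - 2 + α) / (2 + α)

/-- Membership in the space `E`: a `C¹` function on `(0,∞)` with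
`∫₀^∞ t^k ((w')² + w²) dt < ∞`. -/
def memE (k : ℝ) (w : ℝ → ℝ) : Prop :=
  ContDiffOn ℝ 1 w (Ioi 0) ∧
  IntegrableOn (fun t => t ^ k * ((deriv w t) ^ 2 + (w t) ^ 2)) (Ioi 0)

/-- The Rayleigh quotient
`R(w) = (∫₀^∞ t^k ((w')² − A·w²) dt) / (∫₀^∞ t^k w² dt)`. -/
noncomputable def Ray (k : ℝ) (A : ℝ → ℝ) (w : ℝ → ℝ) : ℝ :=
  (∫ t in Ioi (0:ℝ), t ^ k * ((deriv w t) ^ 2 - A t * (w t) ^ 2)) /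
    ∫ t in Ioi (0:ℝ), t ^ k * (w t) ^ 2

/-- Morse index one: the infimum of the Rayleigh quotient over nonzero elements of `E`
is negative, while on every two-dimensional subspace of `E` the maximum of the
Rayleigh quotient over nonzero elements is nonnegative. -/
def MorseIndexOne (k : ℝ) (A : ℝ → ℝ) : Prop :=
  (∃ w, memE k w ∧ (∃ t ∈ Ioi (0:ℝ), w t ≠ 0) ∧ Ray k A w < 0) ∧
  ∀ w₁ w₂ : ℝ → ℝ, memE k w₁ → memE k w₂ →
    (∀ c₁ c₂ : ℝ, (∀ t ∈ Ioi (0:ℝ), c₁ * w₁ t + c₂ * w₂ t = 0) → c₁ = 0 ∧ c₂ = 0) →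
    ∃ c₁ c₂ : ℝ, ¬(c₁ = 0 ∧ c₂ = 0) ∧
      0 ≤ Ray k A (fun t => c₁ * w₁ t + c₂ * w₂ t)

/-- Nondegeneracy: the linearized ODE `-w'' - (k/t) w' = A w` has no nontrivial
solution in `E`. -/
def RadNondeg (k : ℝ) (A : ℝ → ℝ) : Prop :=
  ∀ w : ℝ → ℝ, ContDiffOn ℝ 2 w (Ioi 0) → memE k w →
    (∀ t > (0:ℝ), -(deriv (deriv w) t) - k / t * deriv w t = A t * w t) →
    ∀ t > (0:ℝ), w t = 0

/-- A solution in `E` of the linearized ODE `-ψ'' - (k/t) ψ' = A ψ` on `(0,∞)`. -/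
def LinODESol (k : ℝ) (A : ℝ → ℝ) (ψ : ℝ → ℝ) : Prop :=
  ContDiffOn ℝ 2 ψ (Ioi 0) ∧ memE k ψ ∧
  ∀ t > (0:ℝ), -(deriv (deriv ψ) t) - k / t * deriv ψ t = A t * ψ t

/-- A solution of the linearized problem `-Δw = |x|^α a w` on `ℝ^N∖{0}` with
`|x|^{α/2} w ∈ L²(ℝ^N)` and `|∇w| ∈ L²(ℝ^N)`. -/
def LinSolution (N : ℕ) (α : ℝ) (a : EuclideanSpace ℝ (Fin N) → ℝ)
    (w : EuclideanSpace ℝ (Fin N) → ℝ) : Prop :=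
  ContDiffOn ℝ 2 w {x | x ≠ 0} ∧
  (∀ x : EuclideanSpace ℝ (Fin N), x ≠ 0 → -(lap w x) = ‖x‖ ^ α * a x * w x) ∧
  Integrable (fun x : EuclideanSpace ℝ (Fin N) => ‖x‖ ^ α * (w x) ^ 2) ∧
  Integrable (fun x : EuclideanSpace ℝ (Fin N) => ‖fderiv ℝ w x‖ ^ 2)

/-- `(N+2i)·(N+i-2)! / ((N-2)!·(i+1)!)`. -/
def dimN (N i : ℕ) : ℕ :=
  (N + 2 * i) * Nat.factorial (N + i - 2) / (Nat.factorial (N - 2) * Nat.factorial (i + 1))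

namespace MvPolynomial

variable {σ : Type*}

/-- The Laplacian of a polynomial. -/
noncomputable def laplacian [Fintype σ] : MvPolynomial σ ℝ →ₗ[ℝ] MvPolynomial σ ℝ :=
  ∑ j, (pderiv j).toLinearMap ∘ₗ (pderiv j).toLinearMap

theorem laplacian_apply [Fintype σ] (p : MvPolynomial σ ℝ) :
    laplacian p = ∑ j, pderiv j (pderiv j p) := by
  simp [laplacian]

/-- The polynomial `∑ Xⱼ²`. -/
noncomputable def normSq (σ : Type*) [Fintype σ] : MvPolynomial σ ℝ := ∑ j, X j ^ 2

/-- The Fischer pairing `∑ m! pₘ qₘ` of polynomials. -/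
noncomputable def fischer : MvPolynomial σ ℝ →ₗ[ℝ] MvPolynomial σ ℝ →ₗ[ℝ] ℝ :=
  (basisMonomials σ ℝ).constr ℝ
    fun m => (m.prod fun _ k => (k.factorial : ℝ)) • (lcoeff ℝ m)

theorem fischer_monomial (m : σ →₀ ℕ) (a : ℝ) (q : MvPolynomial σ ℝ) :
    fischer (monomial m a) q = a * (m.prod fun _ k => (k.factorial : ℝ)) * coeff m q := by
  have h : fischer (basisMonomials σ ℝ m) =
      (m.prod fun _ k => (k.factorial : ℝ)) • (lcoeff ℝ m) :=
    (basisMonomials σ ℝ).constr_basis ℝ _ m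
  have h2 : monomial m a = a • (basisMonomials σ ℝ m) := by
    simp [smul_monomial]
  rw [h2, map_smul, h]
  simp [mul_assoc]

theorem eq_zero_of_fischer_self_eq_zero {p : MvPolynomial σ ℝ} (h : fischer p p = 0) : p = 0 := by
  have h1 : fischer p p =
      ∑ m ∈ p.support, (m.prod fun _ k => (k.factorial : ℝ)) * coeff m p ^ 2 := by
    conv_lhs => enter [1, 2]; rw [p.as_sum]
    rw [map_sum, LinearMap.sum_apply]
    refine Finset.sum_congr rfl fun m _ => ?_
    rw [fischer_monomial]; ring
  have hpos : ∀ m : σ →₀ ℕ, 0 < (m.prod fun _ k => (k.factorial : ℝ)) := fun m =>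
    Finset.prod_pos fun i _ => by positivity
  rw [h1, Finset.sum_eq_zero_iff_of_nonneg
    (fun m _ => mul_nonneg (hpos m).le (sq_nonneg _))] at h
  ext m
  by_cases hm : m ∈ p.support
  · have := h m hm
    simpa [(hpos m).ne'] using this
  · simpa using hm

theorem fischer_pderiv (j : σ) (p q : MvPolynomial σ ℝ) :
    fischer (pderiv j p) q = fischer p (X j * q) := by
  classical
  induction p using MvPolynomial.induction_on' with
  | add p₁ p₂ h₁ h₂ => simp [h₁, h₂]
  | monomial m a =>
    rw [pderiv_monomial, fischer_monomial, fischer_monomial]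
    by_cases hm : m j = 0
    · have : coeff m (X j * q) = 0 := by
        rw [coeff_X_mul', if_neg (by simpa using hm)]
      simp [hm, this]
    · obtain ⟨n, rfl⟩ : ∃ n, m = n + Finsupp.single j 1 :=
        ⟨m - Finsupp.single j 1, (tsub_add_cancel_of_le
          (Finsupp.single_le_iff.2 (Nat.one_le_iff_ne_zero.2 hm))).symm⟩
      have key : ((n + Finsupp.single j 1).prod fun _ k => (k.factorial : ℝ)) =
          (n j + 1) * n.prod fun _ k => (k.factorial : ℝ) := by
        have e1 : ∀ r : σ →₀ ℕ, r.support ⊆ insert j n.support →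
            (r.prod fun _ k => (k.factorial : ℝ)) =
              ∏ i ∈ insert j n.support, ((r i).factorial : ℝ) := fun r hr =>
          Finsupp.prod_of_support_subset _ hr _ (by simp)
        rw [e1 _ (Finsupp.support_add.trans (by
            refine Finset.union_subset (Finset.subset_insert _ _) ?_
            exact (Finsupp.support_single_subset).trans (by simp))),
          e1 n (Finset.subset_insert _ _),
          ← Finset.mul_prod_erase _ _ (Finset.mem_insert_self j _),
          ← Finset.mul_prod_erase _ (fun i => ((n i).factorial : ℝ))
            (Finset.mem_insert_self j _)]
        have e2 : ∏ i ∈ (insert j n.support).erase j,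
            ((((n + Finsupp.single j 1 : σ →₀ ℕ)) i).factorial : ℝ) =
            ∏ i ∈ (insert j n.support).erase j, ((n i).factorial : ℝ) := by
          refine Finset.prod_congr rfl fun i hi => ?_
          have : i ≠ j := (Finset.mem_erase.1 hi).1
          simp [this.symm]
        rw [e2]
        simp [Nat.factorial_succ]
        ring
      rw [key, mul_comm (X j) q, coeff_mul_X]
      simp only [add_tsub_cancel_right, Finsupp.add_apply, Finsupp.single_eq_same, Nat.cast_add,
        Nat.cast_one]
      ring

variable [Fintype σ]

theorem fischer_laplacian (p q : MvPolynomial σ ℝ) :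
    fischer (laplacian p) q = fischer p (normSq σ * q) := by
  simp only [laplacian_apply, normSq, map_sum, LinearMap.sum_apply, Finset.sum_mul]
  refine Finset.sum_congr rfl fun j _ => ?_
  rw [fischer_pderiv, fischer_pderiv]
  congr 1; ring

theorem IsHomogeneous.laplacian {p : MvPolynomial σ ℝ} {l : ℕ} (hp : p.IsHomogeneous (l + 2)) :
    (laplacian p).IsHomogeneous l := by
  rw [laplacian_apply]
  exact IsHomogeneous.sum _ _ _ fun j _ => hp.pderiv.pderiv

theorem isHomogeneous_normSq : (normSq σ).IsHomogeneous 2 :=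
  IsHomogeneous.sum _ _ _ fun j _ => by simpa using (isHomogeneous_X ℝ j).pow 2

theorem normSq_ne_zero [Nonempty σ] : normSq σ ≠ 0 := by
  intro h
  have := congrArg (eval fun _ => (1 : ℝ)) h
  simp [normSq] at this

/-- Harmonic homogeneous polynomials of degree `l`. -/
noncomputable def harmonicSubmodule (σ : Type*) [Fintype σ] (l : ℕ) :
    Submodule ℝ (MvPolynomial σ ℝ) :=
  homogeneousSubmodule σ ℝ l ⊓ LinearMap.ker laplacian

instance (l : ℕ) : FiniteDimensional ℝ (homogeneousSubmodule σ ℝ l) :=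
  Module.Finite.iff_fg.2 (homogeneousSubmodule_fg σ ℝ l)

instance (l : ℕ) : FiniteDimensional ℝ (harmonicSubmodule σ l) :=
  Submodule.finiteDimensional_of_le
    (inf_le_left : harmonicSubmodule σ l ≤ homogeneousSubmodule σ ℝ l)

/-- The Laplacian maps onto the homogeneous polynomials; more precisely it is already onto
on multiples of `normSq`. -/
theorem exists_laplacian_normSq_mul_eq [Nonempty σ] {l : ℕ} {p : MvPolynomial σ ℝ}
    (hp : p.IsHomogeneous l) :
    ∃ q : MvPolynomial σ ℝ, q.IsHomogeneous l ∧ laplacian (normSq σ * q) = p := by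
  have hmap : ∀ q ∈ homogeneousSubmodule σ ℝ l,
      (laplacian ∘ₗ LinearMap.mulLeft ℝ (normSq σ)) q ∈ homogeneousSubmodule σ ℝ l := by
    intro q hq
    have : (normSq σ * q).IsHomogeneous (l + 2) := by
      rw [add_comm]; exact isHomogeneous_normSq.mul hq
    exact this.laplacian
  have hinj : Function.Injective
      ((laplacian ∘ₗ LinearMap.mulLeft ℝ (normSq σ)).restrict hmap) := by
    rw [injective_iff_map_eq_zero]
    rintro ⟨q, hq⟩ h
    have h0 : laplacian (normSq σ * q) = 0 := congrArg Subtype.val h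
    have h1 : normSq σ * q = 0 := by
      apply eq_zero_of_fischer_self_eq_zero
      rw [← fischer_laplacian, h0]; simp
    exact Subtype.ext ((mul_eq_zero.1 h1).resolve_left normSq_ne_zero)
  obtain ⟨⟨q, hq⟩, h⟩ := LinearMap.injective_iff_surjective.1 hinj ⟨p, hp⟩
  exact ⟨q, hq, congrArg Subtype.val h⟩

theorem exists_harmonic_add_normSq_mul [Nonempty σ] {l : ℕ} {p : MvPolynomial σ ℝ}
    (hp : p.IsHomogeneous (l + 2)) :
    ∃ h ∈ harmonicSubmodule σ (l + 2), ∃ q : MvPolynomial σ ℝ, q.IsHomogeneous l ∧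
      p = h + normSq σ * q := by
  obtain ⟨q, hq, e⟩ := exists_laplacian_normSq_mul_eq hp.laplacian
  refine ⟨p - normSq σ * q, ⟨?_, ?_⟩, q, hq, by ring⟩
  · refine Submodule.sub_mem _ hp ?_
    rw [mem_homogeneousSubmodule, add_comm]
    exact isHomogeneous_normSq.mul hq
  · simp [e]

theorem finrank_harmonicSubmodule_add [Nonempty σ] (l : ℕ) :
    Module.finrank ℝ (harmonicSubmodule σ (l + 2)) +
      Module.finrank ℝ (homogeneousSubmodule σ ℝ l) =
      Module.finrank ℝ (homogeneousSubmodule σ ℝ (l + 2)) := by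
  let f : homogeneousSubmodule σ ℝ (l + 2) →ₗ[ℝ] homogeneousSubmodule σ ℝ l :=
    laplacian.restrict fun p hp => IsHomogeneous.laplacian hp
  have hsurj : Function.Surjective f := by
    rintro ⟨p, hp⟩
    obtain ⟨q, hq, e⟩ := exists_laplacian_normSq_mul_eq hp
    refine ⟨⟨normSq σ * q, ?_⟩, Subtype.ext e⟩
    rw [mem_homogeneousSubmodule, add_comm]
    exact isHomogeneous_normSq.mul hq
  have hker : Module.finrank ℝ (LinearMap.ker f) =
      Module.finrank ℝ (harmonicSubmodule σ (l + 2)) := by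
    rw [← LinearMap.finrank_range_of_inj (f := (homogeneousSubmodule σ ℝ (l + 2)).subtype ∘ₗ
      (LinearMap.ker f).subtype) (by
        rw [LinearMap.coe_comp]
        exact (Submodule.injective_subtype _).comp (Submodule.injective_subtype _))]
    refine LinearEquiv.finrank_eq (LinearEquiv.ofEq _ _ ?_)
    ext p
    constructor
    · rintro ⟨⟨⟨p, hp⟩, h⟩, rfl⟩
      exact ⟨hp, congrArg Subtype.val (LinearMap.mem_ker.1 h)⟩
    · rintro ⟨hp, h⟩
      exact ⟨⟨⟨p, hp⟩, LinearMap.mem_ker.2 (Subtype.ext (LinearMap.mem_ker.1 h))⟩, rfl⟩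
  rw [← LinearMap.finrank_range_add_finrank_ker f, LinearMap.range_eq_top.2 hsurj, finrank_top,
    hker, add_comm]

theorem finrank_homogeneousSubmodule (N l : ℕ) :
    Module.finrank ℝ (homogeneousSubmodule (Fin N) ℝ l) = N.multichoose l := by
  classical
  have e : homogeneousSubmodule (Fin N) ℝ l =
      restrictSupport ℝ ((Finset.univ.finsuppAntidiag l : Finset (Fin N →₀ ℕ)) : Set _) := by
    rw [homogeneousSubmodule_eq_finsupp_supported]
    congr 1
    ext d
    simp [Finset.mem_finsuppAntidiag, Finsupp.degree_eq_sum]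
  rw [e, Module.finrank_eq_card_basis (basisRestrictSupport ℝ _)]
  simp [Finset.card_finsuppAntidiag_nat_eq_multichoose]

theorem finrank_harmonicSubmodule {N i : ℕ} (hN : 3 ≤ N) (hi : 0 < i) :
    Module.finrank ℝ (harmonicSubmodule (Fin N) (i + 1)) = dimN N i := by
  obtain ⟨i, rfl⟩ := Nat.exists_eq_succ_of_ne_zero hi.ne'
  obtain ⟨N, rfl⟩ := Nat.exists_eq_add_of_le hN
  have : Nonempty (Fin (3 + N)) := ⟨⟨0, by omega⟩⟩
  have h := finrank_harmonicSubmodule_add (σ := Fin (3 + N)) i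
  rw [finrank_homogeneousSubmodule, finrank_homogeneousSubmodule, Nat.multichoose_eq,
    Nat.multichoose_eq] at h
  simp only [Nat.succ_eq_add_one] at *
  have e1 : (3 + N + (i + 2) - 1).choose (i + 2) * ((i + 2).factorial * (N + 2).factorial) =
      (N + i + 4).factorial := by
    have := Nat.choose_mul_factorial_mul_factorial (n := N + i + 4) (k := i + 2) (by omega)
    rw [show N + i + 4 - (i + 2) = N + 2 by omega] at this
    rw [show 3 + N + (i + 2) - 1 = N + i + 4 by omega, ← this]; ring
  have e2 : (3 + N + i - 1).choose i * (i.factorial * (N + 2).factorial) =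
      (N + i + 2).factorial := by
    have := Nat.choose_mul_factorial_mul_factorial (n := N + i + 2) (k := i) (by omega)
    rw [show N + i + 2 - i = N + 2 by omega] at this
    rw [show 3 + N + i - 1 = N + i + 2 by omega, ← this]; ring
  set a := (3 + N + (i + 2) - 1).choose (i + 2)
  set b := (3 + N + i - 1).choose i
  rw [dimN, show 3 + N + (i + 1) - 2 = N + i + 2 by omega, show 3 + N - 2 = N + 1 by omega,
    show i + 1 + 1 = i + 2 by ring]
  symm
  apply Nat.div_eq_of_eq_mul_left (by positivity)
  have h2 : 0 < N + 2 := by omega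
  apply Nat.eq_of_mul_eq_mul_left h2
  set d := Module.finrank ℝ (harmonicSubmodule (Fin (3 + N)) (i + 2))
  simp only [Nat.factorial_succ, show N + i + 4 = (N + i + 3) + 1 from rfl,
    show N + i + 3 = (N + i + 2) + 1 from rfl] at e1 e2 ⊢
  have e3 : ((d : ℤ) + b) = a := by exact_mod_cast h
  zify at e1 e2 ⊢
  rw [← e3] at e1
  linear_combination (-1 : ℤ) * e1 + (i + 1) * (i + 2) * e2

end MvPolynomial

section PolynomialFunctions

open MvPolynomial

variable {N : ℕ}

/-- The product of a radial function and a polynomial function. -/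
noncomputable def radPoly (g : ℝ → ℝ) (p : MvPolynomial (Fin N) ℝ)
    (x : EuclideanSpace ℝ (Fin N)) : ℝ :=
  g ‖x‖ * eval x.ofLp p

theorem contDiff_eval (p : MvPolynomial (Fin N) ℝ) {n : WithTop ℕ∞} :
    ContDiff ℝ n fun x : EuclideanSpace ℝ (Fin N) => eval x.ofLp p := by
  induction p using MvPolynomial.induction_on with
  | C a => simpa using contDiff_const
  | add p q hp hq => simpa using hp.add hq
  | mul_X p j hp =>
    simpa using hp.mul (EuclideanSpace.proj (𝕜 := ℝ) j : EuclideanSpace ℝ (Fin N) →L[ℝ] ℝ).contDiff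

theorem continuous_eval_ofLp (p : MvPolynomial (Fin N) ℝ) :
    Continuous fun x : EuclideanSpace ℝ (Fin N) => eval x.ofLp p :=
  (contDiff_eval p (n := 0)).continuous

theorem fderiv_eval (p : MvPolynomial (Fin N) ℝ) (x : EuclideanSpace ℝ (Fin N)) (j : Fin N) :
    fderiv ℝ (fun x : EuclideanSpace ℝ (Fin N) => eval x.ofLp p) x
      (EuclideanSpace.single j 1) = eval x.ofLp (pderiv j p) := by
  have hd : ∀ p : MvPolynomial (Fin N) ℝ,
      DifferentiableAt ℝ (fun x : EuclideanSpace ℝ (Fin N) => eval x.ofLp p) x := fun p =>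
    ((contDiff_eval p (n := 1)).differentiable one_ne_zero) x
  induction p using MvPolynomial.induction_on with
  | C a => simp
  | add p q hp hq =>
    simp only [map_add]
    rw [fderiv_fun_add (hd p) (hd q)]
    simp [hp, hq]
  | mul_X p i hp =>
    have h1 : HasFDerivAt (fun x : EuclideanSpace ℝ (Fin N) => x.ofLp i)
        (EuclideanSpace.proj (𝕜 := ℝ) i : EuclideanSpace ℝ (Fin N) →L[ℝ] ℝ) x :=
      (EuclideanSpace.proj (𝕜 := ℝ) i : EuclideanSpace ℝ (Fin N) →L[ℝ] ℝ).hasFDerivAt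
    simp only [map_mul, eval_X]
    rw [((hd p).hasFDerivAt.fun_mul h1).fderiv]
    by_cases hij : i = j
    · subst hij
      simp [hp]
    · simp [hp, hij, pderiv_X_of_ne hij]

theorem fderiv_apply_eq_sum (f : EuclideanSpace ℝ (Fin N) → ℝ) (x v : EuclideanSpace ℝ (Fin N)) :
    fderiv ℝ f x v = ∑ j, v.ofLp j * fderiv ℝ f x (EuclideanSpace.single j 1) := by
  have hv : v = ∑ j, v.ofLp j • (EuclideanSpace.single j (1 : ℝ)) := by
    ext i
    simp [Finset.sum_apply, Pi.single_apply]
  conv_lhs => rw [hv]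
  simp

theorem hasFDerivAt_norm {x : EuclideanSpace ℝ (Fin N)} (hx : x ≠ 0) :
    HasFDerivAt (fun x : EuclideanSpace ℝ (Fin N) => ‖x‖) (‖x‖⁻¹ • innerSL ℝ x) x := by
  have h := (hasStrictFDerivAt_norm_sq x).hasFDerivAt.sqrt (by simpa using hx)
  simp only [Real.sqrt_sq (norm_nonneg _)] at h
  have e : (1 / (2 * ‖x‖)) • 2 • innerSL ℝ x = ‖x‖⁻¹ • innerSL ℝ x := by
    rw [← Nat.cast_smul_eq_nsmul ℝ, smul_smul]
    congr 1
    push_cast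
    field_simp
  rwa [e] at h

theorem hasFDerivAt_radPoly {g : ℝ → ℝ} (p : MvPolynomial (Fin N) ℝ)
    {x : EuclideanSpace ℝ (Fin N)} (hx : x ≠ 0) (hg : DifferentiableAt ℝ g ‖x‖) :
    HasFDerivAt (radPoly g p)
      (g ‖x‖ • fderiv ℝ (fun x : EuclideanSpace ℝ (Fin N) => eval x.ofLp p) x +
        eval x.ofLp p • (deriv g ‖x‖ • (‖x‖⁻¹ • innerSL ℝ x))) x := by
  have h1 : HasFDerivAt (fun x : EuclideanSpace ℝ (Fin N) => eval x.ofLp p) _ x :=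
    (((contDiff_eval p (n := 1)).differentiable one_ne_zero) x).hasFDerivAt
  exact (hg.hasDerivAt.comp_hasFDerivAt x (hasFDerivAt_norm hx)).mul h1

theorem fderiv_radPoly {g : ℝ → ℝ} (p : MvPolynomial (Fin N) ℝ)
    {x : EuclideanSpace ℝ (Fin N)} (hx : x ≠ 0) (hg : DifferentiableAt ℝ g ‖x‖) (j : Fin N) :
    fderiv ℝ (radPoly g p) x (EuclideanSpace.single j 1) =
      radPoly (fun r => deriv g r / r) (X j * p) x + radPoly g (pderiv j p) x := by
  rw [(hasFDerivAt_radPoly p hx hg).fderiv]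
  simp [radPoly, fderiv_eval, EuclideanSpace.inner_single_right]
  ring

theorem contDiffOn_radPoly {g : ℝ → ℝ} {n : WithTop ℕ∞} (hg : ContDiffOn ℝ n g (Ioi 0))
    (p : MvPolynomial (Fin N) ℝ) :
    ContDiffOn ℝ n (radPoly g p) {x | x ≠ 0} := by
  refine ContDiffOn.mul (hg.comp (t := Ioi 0) ?_ ?_) (contDiff_eval p).contDiffOn
  · exact fun x hx => (contDiffAt_norm ℝ hx).contDiffWithinAt
  · exact fun x hx => norm_pos_iff.2 hx

theorem IsHomogeneous_eval_smul {p : MvPolynomial (Fin N) ℝ} {l : ℕ} (hp : p.IsHomogeneous l)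
    (r : ℝ) (x : EuclideanSpace ℝ (Fin N)) :
    eval (r • x).ofLp p = r ^ l * eval x.ofLp p := by
  rw [eval_eq, eval_eq, Finset.mul_sum]
  refine Finset.sum_congr rfl fun d hd => ?_
  have hd' : d.degree = l := by
    rw [Finsupp.degree_eq_weight_one]
    exact hp (mem_support_iff.1 hd)
  simp only [PiLp.smul_apply, smul_eq_mul, mul_pow, Finset.prod_mul_distrib]
  rw [Finset.prod_pow_eq_pow_sum, ← hd', Finsupp.degree_apply]
  ring

theorem sum_eval_X_mul_pderiv {p : MvPolynomial (Fin N) ℝ} {l : ℕ} (hp : p.IsHomogeneous l)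
    (y : Fin N → ℝ) : ∑ j, y j * eval y (pderiv j p) = l * eval y p := by
  have := congrArg (eval y) hp.sum_X_mul_pderiv
  simpa using this

theorem lap_radPoly {g : ℝ → ℝ} (hg : ContDiffOn ℝ 2 g (Ioi 0)) {l : ℕ}
    {p : MvPolynomial (Fin N) ℝ} (hp : p ∈ harmonicSubmodule (Fin N) l)
    {x : EuclideanSpace ℝ (Fin N)} (hx : x ≠ 0) :
    lap (radPoly g p) x =
      radPoly (fun r => deriv (deriv g) r + (N - 1 + 2 * l) / r * deriv g r) p x := by
  have hr : 0 < ‖x‖ := norm_pos_iff.2 hx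
  have hg1 : ∀ r > 0, DifferentiableAt ℝ g r := fun r hr =>
    (hg.differentiableOn two_ne_zero).differentiableAt (Ioi_mem_nhds hr)
  have hg2 : ∀ r > 0, DifferentiableAt ℝ (deriv g) r := fun r hr =>
    ((hg.deriv_of_isOpen isOpen_Ioi (m := 1) (by norm_num)).differentiableOn
      one_ne_zero).differentiableAt (Ioi_mem_nhds hr)
  have hh : HasDerivAt (fun r => deriv g r / r)
      ((deriv (deriv g) ‖x‖ * ‖x‖ - deriv g ‖x‖ * 1) / ‖x‖ ^ 2) ‖x‖ :=
    (hg2 _ hr).hasDerivAt.div (hasDerivAt_id _) hr.ne'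
  have hterm : ∀ j : Fin N, fderiv ℝ (fun y => fderiv ℝ (radPoly g p) y
      (EuclideanSpace.single j 1)) x (EuclideanSpace.single j 1) =
      (deriv (deriv g) ‖x‖ * ‖x‖ - deriv g ‖x‖) / ‖x‖ ^ 3 * (x.ofLp j ^ 2 * eval x.ofLp p) +
      deriv g ‖x‖ / ‖x‖ * (eval x.ofLp p + 2 * (x.ofLp j * eval x.ofLp (pderiv j p))) +
      g ‖x‖ * eval x.ofLp (pderiv j (pderiv j p)) := by
    intro j
    have hev : (fun y => fderiv ℝ (radPoly g p) y (EuclideanSpace.single j 1)) =ᶠ[𝓝 x]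
        fun y => radPoly (fun r => deriv g r / r) (X j * p) y + radPoly g (pderiv j p) y := by
      filter_upwards [isOpen_ne.mem_nhds hx] with y hy
      exact fderiv_radPoly p hy (hg1 _ (norm_pos_iff.2 hy)) j
    rw [hev.fderiv_eq, fderiv_fun_add
      (hasFDerivAt_radPoly _ hx hh.differentiableAt).differentiableAt
      (hasFDerivAt_radPoly _ hx (hg1 _ hr)).differentiableAt,
      _root_.add_apply,
      fderiv_radPoly _ hx hh.differentiableAt, fderiv_radPoly _ hx (hg1 _ hr)]
    simp only [radPoly, hh.deriv, map_mul, eval_X, pderiv_mul, pderiv_X_self, map_add, map_one]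
    field_simp
    ring
  have hlap : ∑ j, eval x.ofLp (pderiv j (pderiv j p)) = 0 := by
    have := congrArg (eval x.ofLp) (LinearMap.mem_ker.1 hp.2)
    rwa [laplacian_apply, map_sum, map_zero] at this
  have hn : ∑ j, x.ofLp j ^ 2 = ‖x‖ ^ 2 := by
    rw [EuclideanSpace.real_norm_sq_eq]
  simp only [lap, hterm, Finset.sum_add_distrib, ← Finset.mul_sum, ← Finset.sum_mul, hn, hlap,
    sum_eval_X_mul_pderiv hp.1, radPoly]
  simp
  field_simp
  ring

theorem IsHomogeneous_abs_eval_le {p : MvPolynomial (Fin N) ℝ} {l : ℕ}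
    (hp : p.IsHomogeneous l) :
    ∃ C, 0 ≤ C ∧ ∀ x : EuclideanSpace ℝ (Fin N), x ≠ 0 → |eval x.ofLp p| ≤ C * ‖x‖ ^ l := by
  obtain ⟨C, hC⟩ := (isCompact_sphere (0 : EuclideanSpace ℝ (Fin N)) 1).exists_bound_of_continuousOn
    (continuous_eval_ofLp p).continuousOn
  refine ⟨max C 0, le_max_right _ _, fun x hx => ?_⟩
  have hr : 0 < ‖x‖ := norm_pos_iff.2 hx
  have h1 : x = ‖x‖ • (‖x‖⁻¹ • x) := by rw [smul_smul, mul_inv_cancel₀ hr.ne', one_smul]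
  have h2 := hC (‖x‖⁻¹ • x) (by simp [norm_smul, hr.ne'])
  rw [h1, IsHomogeneous_eval_smul hp, ← h1, abs_mul, abs_pow, abs_norm, mul_comm]
  exact mul_le_mul_of_nonneg_right (h2.trans (le_max_left _ _)) (by positivity)

theorem eq_zero_of_eval_sphere_eq_zero {p : MvPolynomial (Fin N) ℝ} {l : ℕ}
    (hp : p.IsHomogeneous (l + 1))
    (h : ∀ x : EuclideanSpace ℝ (Fin N), ‖x‖ = 1 → eval x.ofLp p = 0) : p = 0 := by
  refine MvPolynomial.funext fun y => ?_
  rw [map_zero]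
  set x : EuclideanSpace ℝ (Fin N) := WithLp.toLp 2 y with hxy
  change eval x.ofLp p = 0
  by_cases hx : x = 0
  · have := IsHomogeneous_eval_smul hp 0 x
    simpa [hx] using this
  · have hr : 0 < ‖x‖ := norm_pos_iff.2 hx
    have h1 : x = ‖x‖ • (‖x‖⁻¹ • x) := by rw [smul_smul, mul_inv_cancel₀ hr.ne', one_smul]
    rw [h1, IsHomogeneous_eval_smul hp, h _ (by simp [norm_smul, hr.ne']), mul_zero]

end PolynomialFunctions

section SphericalProjection

open MvPolynomial

variable {N : ℕ}

local notation "𝔼" => EuclideanSpace ℝ (Fin N)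

theorem integrable_and_integral_polar [NeZero N] {f : 𝔼 → ℝ} (hf : Integrable f) :
    IntegrableOn (fun r => r ^ (N - 1) *
      ∫ θ : Metric.sphere (0 : 𝔼) 1, f (r • θ.1) ∂(volume : Measure 𝔼).toSphere) (Ioi 0) ∧
    ∫ x, f x = ∫ r in Ioi (0 : ℝ), r ^ (N - 1) *
      ∫ θ : Metric.sphere (0 : 𝔼) 1, f (r • θ.1) ∂(volume : Measure 𝔼).toSphere := by
  set g : Metric.sphere (0 : 𝔼) 1 × Ioi (0 : ℝ) → ℝ := fun z => f (z.2.1 • z.1.1) with hg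
  have hmp := (volume : Measure 𝔼).measurePreserving_homeomorphUnitSphereProd
  have hfin : Module.finrank ℝ 𝔼 = N := by simp
  rw [hfin] at hmp
  have hcomp : g ∘ homeomorphUnitSphereProd 𝔼 = fun x => f x.1 := by
    funext x
    have hx : ‖x.1‖ ≠ 0 := norm_ne_zero_iff.2 x.2
    simp [hg, smul_smul, hx]
  have hgi : Integrable g ((volume : Measure 𝔼).toSphere.prod (.volumeIoiPow (N - 1))) := by
    rw [← hmp.integrable_comp_emb (Homeomorph.measurableEmbedding _), hcomp]
    have := (integrableOn_iff_comap_subtypeVal (f := f) (μ := volume)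
      (measurableSet_singleton (0 : 𝔼)).compl).1 hf.integrableOn
    exact this
  have hint :
      ∫ x, f x = ∫ z, g z ∂((volume : Measure 𝔼).toSphere.prod (.volumeIoiPow (N - 1))) := by
    rw [← hmp.integral_comp (Homeomorph.measurableEmbedding _)]
    change _ = ∫ x, (g ∘ homeomorphUnitSphereProd 𝔼) x ∂_
    rw [hcomp, integral_subtype_comap (measurableSet_singleton (0 : 𝔼)).compl f,
      restrict_compl_singleton]
  constructor
  · have h1 := hgi.integral_prod_right
    rw [Measure.volumeIoiPow, integrable_withDensity_iff_integrable_smul' (by fun_prop)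
      (by simp)] at h1
    rw [integrableOn_iff_comap_subtypeVal measurableSet_Ioi]
    refine h1.congr (Eventually.of_forall ?_)
    rintro ⟨r, hr : 0 < r⟩
    simp (disch := positivity) [ENNReal.toReal_ofReal, hg]
  · rw [hint, integral_prod_symm _ hgi]
    simp only [Measure.volumeIoiPow, ENNReal.ofReal]
    rw [integral_withDensity_eq_integral_smul
      (measurable_subtype_coe.pow_const _).real_toNNReal,
      integral_subtype_comap measurableSet_Ioi fun a => Real.toNNReal (a ^ (N - 1)) •
        ∫ θ : Metric.sphere (0 : 𝔼) 1, f (a • θ.1) ∂(volume : Measure 𝔼).toSphere]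
    refine setIntegral_congr_fun measurableSet_Ioi fun r hr => ?_
    simp only [NNReal.smul_def, smul_eq_mul]
    rw [Real.coe_toNNReal _ (pow_nonneg hr.out.le _)]

/-- The pairing of a function on the sphere of radius `r` with a polynomial. -/
noncomputable def sphereProj (f : 𝔼 → ℝ) (p : MvPolynomial (Fin N) ℝ) (r : ℝ) : ℝ :=
  ∫ θ : Metric.sphere (0 : 𝔼) 1, f (r • θ.1) * eval θ.1.ofLp p ∂(volume : Measure 𝔼).toSphere

theorem integrable_sphere_of_continuous {f : Metric.sphere (0 : 𝔼) 1 → ℝ} (hf : Continuous f) :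
    Integrable f (volume : Measure 𝔼).toSphere := by
  have : CompactSpace (Metric.sphere (0 : 𝔼) 1) :=
    isCompact_iff_compactSpace.1 (isCompact_sphere _ _)
  exact hf.integrable_of_hasCompactSupport (HasCompactSupport.of_compactSpace f)

theorem continuous_sphere_smul {f : 𝔼 → ℝ} (hf : ContinuousOn f {x | x ≠ 0}) {r : ℝ}
    (hr : 0 < r) : Continuous fun θ : Metric.sphere (0 : 𝔼) 1 => f (r • θ.1) := by
  refine hf.comp_continuous (by fun_prop) fun θ => ?_
  have := ne_zero_of_mem_unit_sphere θ
  simp [hr.ne', this]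

theorem continuous_sphere_eval (p : MvPolynomial (Fin N) ℝ) :
    Continuous fun θ : Metric.sphere (0 : 𝔼) 1 => eval θ.1.ofLp p :=
  (continuous_eval_ofLp p).comp continuous_subtype_val

theorem sphereProj_add {f : 𝔼 → ℝ} (hf : ContinuousOn f {x | x ≠ 0})
    (p q : MvPolynomial (Fin N) ℝ) {r : ℝ} (hr : 0 < r) :
    sphereProj f (p + q) r = sphereProj f p r + sphereProj f q r := by
  simp only [sphereProj, map_add, mul_add]
  exact integral_add
    (integrable_sphere_of_continuous
      ((continuous_sphere_smul hf hr).mul (continuous_sphere_eval p)))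
    (integrable_sphere_of_continuous
      ((continuous_sphere_smul hf hr).mul (continuous_sphere_eval q)))

theorem sphereProj_smul (f : 𝔼 → ℝ) (c : ℝ) (p : MvPolynomial (Fin N) ℝ) (r : ℝ) :
    sphereProj f (c • p) r = c * sphereProj f p r := by
  simp only [sphereProj, smul_eval]
  rw [← integral_const_mul]
  congr 1
  funext θ
  ring

/-- A bound, uniform on a neighbourhood of a radius and on the sphere. -/
theorem exists_bound_near_sphere {f : 𝔼 → ℝ} (hf : ContinuousOn f {x | x ≠ 0}) {r : ℝ}
    (hr : 0 < r) : ∃ C, ∀ s ∈ Icc (r / 2) (2 * r), ∀ θ : Metric.sphere (0 : 𝔼) 1,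
      |f (s • θ.1)| ≤ C := by
  have hK : IsCompact ((fun z : ℝ × 𝔼 => z.1 • z.2) ''
      (Icc (r / 2) (2 * r) ×ˢ Metric.sphere (0 : 𝔼) 1)) :=
    (isCompact_Icc.prod (isCompact_sphere _ _)).image (by fun_prop)
  obtain ⟨C, hC⟩ := hK.exists_bound_of_continuousOn (hf.mono (by
    rintro _ ⟨⟨s, θ⟩, ⟨hs, hθ⟩, rfl⟩
    have h1 : s ≠ 0 := by have := hs.1; dsimp only at this; intro h; linarith
    have h2 : θ ≠ 0 := by rintro rfl; simp at hθ
    exact smul_ne_zero h1 h2))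
  exact ⟨C, fun s hs θ => hC _ ⟨(s, θ.1), ⟨hs, θ.2⟩, rfl⟩⟩

theorem continuousOn_sphereProj {f : 𝔼 → ℝ} (hf : ContinuousOn f {x | x ≠ 0})
    (p : MvPolynomial (Fin N) ℝ) : ContinuousOn (sphereProj f p) (Ioi 0) := by
  intro r hr
  have hr : 0 < r := hr
  refine ContinuousAt.continuousWithinAt ?_
  obtain ⟨C, hC⟩ := exists_bound_near_sphere hf hr
  have hnear : Icc (r / 2) (2 * r) ∈ 𝓝 r := Icc_mem_nhds (by linarith) (by linarith)
  refine continuousAt_of_dominated (bound := fun θ => C * |eval θ.1.ofLp p|) ?_ ?_ ?_ ?_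
  · filter_upwards [lt_mem_nhds hr] with s hs
    exact ((continuous_sphere_smul hf hs).mul
      (continuous_sphere_eval p)).aestronglyMeasurable
  · filter_upwards [hnear] with s hs
    refine Eventually.of_forall fun θ => ?_
    rw [norm_mul]
    exact mul_le_mul_of_nonneg_right (hC s hs θ) (abs_nonneg _)
  · exact integrable_sphere_of_continuous (continuous_const.mul (continuous_sphere_eval p).abs)
  · refine Eventually.of_forall fun θ => ?_
    have h1 : ContinuousAt f (r • θ.1) := hf.continuousAt (isOpen_ne.mem_nhds
      (smul_ne_zero hr.ne' (ne_zero_of_mem_unit_sphere θ)))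
    have h2 : ContinuousAt (fun s : ℝ => s • θ.1) r := by fun_prop
    exact (ContinuousAt.comp (f := fun s : ℝ => s • θ.1) (x := r) h1 h2).mul continuousAt_const

theorem hasDerivAt_sphereProj {f : 𝔼 → ℝ} (hf : ContDiffOn ℝ 1 f {x | x ≠ 0})
    (p : MvPolynomial (Fin N) ℝ) {r : ℝ} (hr : 0 < r) :
    HasDerivAt (sphereProj f p) (∑ j, sphereProj
      (fun x => fderiv ℝ f x (EuclideanSpace.single j 1)) (X j * p) r) r := by
  have hfd : ContinuousOn (fderiv ℝ f) {x | x ≠ 0} :=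
    hf.continuousOn_fderiv_of_isOpen isOpen_ne le_rfl
  have hfj : ∀ j : Fin N, ContinuousOn (fun x => fderiv ℝ f x (EuclideanSpace.single j 1))
      {x | x ≠ 0} := fun j => hfd.clm_apply continuousOn_const
  have hsum : ∀ (s : ℝ) (θ : Metric.sphere (0 : 𝔼) 1),
      fderiv ℝ f (s • θ.1) θ.1 * eval θ.1.ofLp p =
      ∑ j, fderiv ℝ f (s • θ.1) (EuclideanSpace.single j 1) * eval θ.1.ofLp (X j * p) := by
    intro s θ
    rw [fderiv_apply_eq_sum, Finset.sum_mul]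
    refine Finset.sum_congr rfl fun j _ => ?_
    simp only [map_mul, eval_X]
    ring
  choose C hC using fun j => exists_bound_near_sphere (hfj j) hr
  have hnear : Icc (r / 2) (2 * r) ∈ 𝓝 r := Icc_mem_nhds (by linarith) (by linarith)
  have hint : ∀ j, Integrable (fun θ : Metric.sphere (0 : 𝔼) 1 =>
      fderiv ℝ f (r • θ.1) (EuclideanSpace.single j 1) * eval θ.1.ofLp (X j * p))
      (volume : Measure 𝔼).toSphere := fun j =>
    integrable_sphere_of_continuous
      ((continuous_sphere_smul (hfj j) hr).mul (continuous_sphere_eval _))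
  have key := hasDerivAt_integral_of_dominated_loc_of_deriv_le
    (μ := (volume : Measure 𝔼).toSphere) (x₀ := r)
    (F := fun s θ => f (s • θ.1) * eval θ.1.ofLp p)
    (F' := fun s θ => fderiv ℝ f (s • θ.1) θ.1 * eval θ.1.ofLp p)
    (bound := fun θ => ∑ j, C j * |eval θ.1.ofLp (X j * p)|) hnear ?_ ?_ ?_ ?_ ?_ ?_
  · refine key.2.congr_deriv ?_
    rw [integral_congr_ae (Eventually.of_forall fun θ => hsum r θ)]
    exact integral_finsetSum _ fun j _ => hint j
  · filter_upwards [lt_mem_nhds hr] with s hs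
    exact ((continuous_sphere_smul hf.continuousOn hs).mul
      (continuous_sphere_eval p)).aestronglyMeasurable
  · exact integrable_sphere_of_continuous ((continuous_sphere_smul hf.continuousOn hr).mul
      (continuous_sphere_eval p))
  · refine AEStronglyMeasurable.congr ?_ (Eventually.of_forall fun θ => (hsum r θ).symm)
    exact (integrable_finsetSum _ fun j _ => hint j).aestronglyMeasurable
  · refine Eventually.of_forall fun θ s hs => ?_
    rw [hsum]
    refine (norm_sum_le _ _).trans (Finset.sum_le_sum fun j _ => ?_)
    rw [norm_mul]
    exact mul_le_mul_of_nonneg_right (hC j s hs θ) (abs_nonneg _)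
  · exact integrable_finsetSum _ fun j _ =>
      (integrable_sphere_of_continuous (continuous_const.mul (continuous_sphere_eval _).abs))
  · refine Eventually.of_forall fun θ s hs => HasDerivAt.mul_const ?_ _
    have hs0 : s ≠ 0 := by have := hs.1; intro h; linarith
    have h1 : HasFDerivAt f (fderiv ℝ f (s • θ.1)) (s • θ.1) :=
      ((hf.differentiableOn one_ne_zero).differentiableAt (isOpen_ne.mem_nhds
        (smul_ne_zero hs0 (ne_zero_of_mem_unit_sphere θ)))).hasFDerivAt
    have h2 : HasDerivAt (fun s : ℝ => s • θ.1) θ.1 s := by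
      simpa using (hasDerivAt_id s).smul_const θ.1
    exact h1.comp_hasDerivAt (f := fun s : ℝ => s • θ.1) s h2

theorem contDiffOn_sphereProj_one {f : 𝔼 → ℝ} (hf : ContDiffOn ℝ 1 f {x | x ≠ 0})
    (p : MvPolynomial (Fin N) ℝ) : ContDiffOn ℝ 1 (sphereProj f p) (Ioi 0) := by
  have hfd : ContinuousOn (fderiv ℝ f) {x | x ≠ 0} :=
    hf.continuousOn_fderiv_of_isOpen isOpen_ne le_rfl
  rw [show (1 : WithTop ℕ∞) = 0 + 1 from rfl, contDiffOn_succ_iff_deriv_of_isOpen isOpen_Ioi]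
  refine ⟨fun r hr => (hasDerivAt_sphereProj hf p hr).differentiableAt.differentiableWithinAt,
    by simp, ?_⟩
  rw [contDiffOn_zero]
  refine ContinuousOn.congr (continuousOn_finsetSum _ fun j _ => continuousOn_sphereProj
    (f := fun x => fderiv ℝ f x (EuclideanSpace.single j 1)) (p := X j * p)
    (hfd.clm_apply continuousOn_const)) fun r hr => (hasDerivAt_sphereProj hf p hr).deriv

theorem contDiffOn_sphereProj_two {f : 𝔼 → ℝ} (hf : ContDiffOn ℝ 2 f {x | x ≠ 0})
    (p : MvPolynomial (Fin N) ℝ) : ContDiffOn ℝ 2 (sphereProj f p) (Ioi 0) := by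
  have hfd : ContDiffOn ℝ 1 (fderiv ℝ f) {x | x ≠ 0} :=
    hf.fderiv_of_isOpen isOpen_ne (by norm_num)
  have hf1 : ContDiffOn ℝ 1 f {x | x ≠ 0} := hf.of_le (by norm_num)
  rw [show (2 : WithTop ℕ∞) = 1 + 1 by norm_num, contDiffOn_succ_iff_deriv_of_isOpen isOpen_Ioi]
  refine ⟨fun r hr => (hasDerivAt_sphereProj hf1 p hr).differentiableAt.differentiableWithinAt,
    by simp, ?_⟩
  refine ContDiffOn.congr (ContDiffOn.sum fun j _ => contDiffOn_sphereProj_one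
    (f := fun x => fderiv ℝ f x (EuclideanSpace.single j 1)) (p := X j * p)
    (hfd.clm_apply contDiffOn_const)) fun r hr => (hasDerivAt_sphereProj hf1 p hr).deriv

end SphericalProjection

section WeakSymmetry

theorem continuous_mul_of_continuousOn {X : Type*} [TopologicalSpace X] {U : Set X}
    (hU : IsOpen U) {f g : X → ℝ} (hf : ContinuousOn f U) (hg : Continuous g)
    (hgU : tsupport g ⊆ U) : Continuous fun x => f x * g x := by
  refine continuous_of_tsupport fun x hx => ?_
  have hx' : x ∈ tsupport g := closure_mono (Function.support_mul_subset_right _ _) hx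
  exact (hf.continuousAt (hU.mem_nhds (hgU hx'))).mul hg.continuousAt

theorem integrable_mul_of_continuousOn {X : Type*} [TopologicalSpace X] [MeasurableSpace X]
    [OpensMeasurableSpace X] {μ : Measure X} [IsFiniteMeasureOnCompacts μ] {U : Set X}
    (hU : IsOpen U) {f g : X → ℝ} (hf : ContinuousOn f U) (hg : Continuous g)
    (hgc : HasCompactSupport g) (hgU : tsupport g ⊆ U) : Integrable (fun x => f x * g x) μ :=
  (continuous_mul_of_continuousOn hU hf hg hgU).integrable_of_hasCompactSupport hgc.mul_left

theorem integral_mul_fderiv_of_tsupport_subset {E : Type*} [NormedAddCommGroup E]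
    [NormedSpace ℝ E] [MeasurableSpace E] [BorelSpace E] [FiniteDimensional ℝ E]
    {μ : Measure E} [μ.IsAddHaarMeasure] {U : Set E} (hU : IsOpen U) {f g : E → ℝ}
    (hf : ContDiffOn ℝ 1 f U) (hg : ContDiff ℝ 1 g) (hgc : HasCompactSupport g)
    (hgU : tsupport g ⊆ U) (v : E) :
    ∫ x, f x * fderiv ℝ g x v ∂μ = -∫ x, fderiv ℝ f x v * g x ∂μ := by
  have hsub : tsupport (fun x => fderiv ℝ g x v) ⊆ tsupport g := by
    refine (closure_mono fun x hx => ?_).trans (tsupport_fderiv_subset ℝ)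
    intro h
    exact hx (by simp [h])
  refine integral_mul_fderiv_eq_neg_fderiv_mul_of_integrable ?_ ?_ ?_ ?_ ?_
  · exact integrable_mul_of_continuousOn hU
      ((hf.continuousOn_fderiv_of_isOpen hU le_rfl).clm_apply continuousOn_const)
      hg.continuous hgc hgU
  · exact integrable_mul_of_continuousOn hU hf.continuousOn
      ((hg.continuous_fderiv one_ne_zero).clm_apply continuous_const)
      (hgc.mono' (subset_closure.trans hsub)) (hsub.trans hgU)
  · exact integrable_mul_of_continuousOn hU hf.continuousOn hg.continuous hgc hgU
  · exact fun x hx => (hf.differentiableOn one_ne_zero).differentiableAt (hU.mem_nhds (hgU hx))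
  · exact fun x _ => hg.differentiable one_ne_zero x

theorem integral_mul_lap {N : ℕ} {U : Set (EuclideanSpace ℝ (Fin N))} (hU : IsOpen U)
    {f g : EuclideanSpace ℝ (Fin N) → ℝ} (hf : ContDiffOn ℝ 2 f U) (hg : ContDiff ℝ 2 g)
    (hgc : HasCompactSupport g) (hgU : tsupport g ⊆ U) :
    ∫ x, f x * lap g x = ∫ x, lap f x * g x := by
  have hf' : ContDiffOn ℝ 1 (fderiv ℝ f) U := hf.fderiv_of_isOpen hU (by norm_num)
  have hg' : ContDiff ℝ 1 (fderiv ℝ g) := hg.fderiv_right (by norm_num)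
  set e : Fin N → EuclideanSpace ℝ (Fin N) := fun j => EuclideanSpace.single j 1 with he
  have hfj : ∀ j, ContDiffOn ℝ 1 (fun x => fderiv ℝ f x (e j)) U :=
    fun j => hf'.clm_apply contDiffOn_const
  have hgj : ∀ j, ContDiff ℝ 1 (fun x => fderiv ℝ g x (e j)) :=
    fun j => hg'.clm_apply contDiff_const
  have hsub : ∀ j, tsupport (fun x => fderiv ℝ g x (e j)) ⊆ tsupport g := by
    refine fun j => (closure_mono fun x hx => ?_).trans (tsupport_fderiv_subset ℝ)
    intro h
    exact hx (by simp [h])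
  have hsub2 : ∀ j, tsupport (fun x => fderiv ℝ (fun y => fderiv ℝ g y (e j)) x (e j)) ⊆
      tsupport g := by
    refine fun j => ((closure_mono fun x hx => ?_).trans (tsupport_fderiv_subset ℝ)).trans (hsub j)
    intro h
    exact hx (by simp [h])
  simp only [lap, Finset.mul_sum, Finset.sum_mul]
  rw [integral_finsetSum, integral_finsetSum]
  · refine Finset.sum_congr rfl fun j _ => ?_
    rw [integral_mul_fderiv_of_tsupport_subset hU (hf.of_le (by norm_num)) (hgj j)
      (hgc.mono' (subset_closure.trans (hsub j))) ((hsub j).trans hgU) (e j)]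
    have h := integral_mul_fderiv_of_tsupport_subset (μ := volume) hU (hfj j)
      (hg.of_le (by norm_num)) hgc hgU (e j)
    exact neg_eq_iff_eq_neg.2 h
  · exact fun j _ => integrable_mul_of_continuousOn hU
      (((hfj j).continuousOn_fderiv_of_isOpen hU le_rfl).clm_apply continuousOn_const)
      hg.continuous hgc hgU
  · exact fun j _ => integrable_mul_of_continuousOn hU hf.continuousOn
      (((hgj j).continuous_fderiv one_ne_zero).clm_apply continuous_const)
      (hgc.mono' (subset_closure.trans (hsub2 j))) ((hsub2 j).trans hgU)

theorem setIntegral_Ioi_mul_deriv_of_tsupport_subset {u u' v v' : ℝ → ℝ}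
    (hu : ∀ r > 0, HasDerivAt u (u' r) r) (hu' : ContinuousOn u' (Ioi 0))
    (hv : ∀ r, HasDerivAt v (v' r) r) (hv' : Continuous v') (hvc : HasCompactSupport v)
    (hvU : tsupport v ⊆ Ioi 0) :
    ∫ r in Ioi (0 : ℝ), u r * v' r = -∫ r in Ioi (0 : ℝ), u' r * v r := by
  have hv'' : v' = deriv v := funext fun r => (hv r).deriv.symm
  have hsub : tsupport v' ⊆ tsupport v := by
    rw [hv'']
    exact closure_minimal support_deriv_subset (isClosed_tsupport v)
  have hvcont : Continuous v := continuous_iff_continuousAt.2 fun r => (hv r).continuousAt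
  have hucont : ContinuousOn u (Ioi 0) := fun r hr => (hu r hr).continuousAt.continuousWithinAt
  have h := integral_Ioi_mul_deriv_eq_deriv_mul (a := 0) (u := u) (v := v) (u' := u') (v' := v')
    (a' := 0) (b' := 0) hu (fun r _ => hv r)
    (integrable_mul_of_continuousOn isOpen_Ioi hucont hv'
      (hvc.mono' (subset_closure.trans hsub)) (hsub.trans hvU)).integrableOn
    (integrable_mul_of_continuousOn isOpen_Ioi hu' hvcont hvc hvU).integrableOn ?_ ?_
  · simpa using h
  · have h0 : (0 : ℝ) ∉ tsupport v := fun h => lt_irrefl (0 : ℝ) (hvU h)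
    refine Tendsto.congr' ?_ tendsto_const_nhds
    filter_upwards [nhdsWithin_le_nhds ((isClosed_tsupport v).isOpen_compl.mem_nhds h0)] with r hr
    simp [image_eq_zero_of_notMem_tsupport hr]
  · refine Tendsto.congr' ?_ tendsto_const_nhds
    obtain ⟨R, hR⟩ := hvc.isCompact.bddAbove
    filter_upwards [eventually_gt_atTop R] with r hr
    have : r ∉ tsupport v := fun h => absurd (hR h) (not_le.2 hr)
    simp [image_eq_zero_of_notMem_tsupport this]

end WeakSymmetry

section SphericalProjectionODE

open MvPolynomial

variable {N : ℕ}

theorem tsupport_radPoly_subset (g : ℝ → ℝ) (p : MvPolynomial (Fin N) ℝ) :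
    tsupport (radPoly g p) ⊆ (fun x => ‖x‖) ⁻¹' tsupport g := by
  refine closure_minimal (fun x hx => subset_closure ?_)
    ((isClosed_tsupport g).preimage (by fun_prop))
  exact left_ne_zero_of_mul hx

theorem hasCompactSupport_radPoly {g : ℝ → ℝ} (hg : HasCompactSupport g)
    (p : MvPolynomial (Fin N) ℝ) : HasCompactSupport (radPoly g p) := by
  obtain ⟨R, hR⟩ := hg.isCompact.bddAbove
  refine (isCompact_closedBall (0 : EuclideanSpace ℝ (Fin N)) R).of_isClosed_subset
    (isClosed_tsupport _) fun x hx => ?_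
  simpa using hR (tsupport_radPoly_subset g p hx)

theorem contDiff_radPoly {g : ℝ → ℝ} {n : WithTop ℕ∞} (hg : ContDiff ℝ n g)
    (hgU : tsupport g ⊆ Ioi 0) (p : MvPolynomial (Fin N) ℝ) : ContDiff ℝ n (radPoly g p) := by
  refine contDiff_iff_contDiffAt.2 fun x => ?_
  by_cases hx : x ∈ tsupport (radPoly g p)
  swap
  · exact contDiffAt_const.congr_of_eventuallyEq (notMem_tsupport_iff_eventuallyEq.1 hx)
  have hx0 : x ≠ 0 := norm_pos_iff.1 (hgU (tsupport_radPoly_subset g p hx))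
  exact (contDiffOn_radPoly hg.contDiffOn p).contDiffAt (isOpen_ne.mem_nhds hx0)

theorem integral_sphereProj_weak [NeZero N] {w : EuclideanSpace ℝ (Fin N) → ℝ}
    (hw : ContDiffOn ℝ 2 w {x | x ≠ 0}) {b : ℝ → ℝ} (hb : ContinuousOn b (Ioi 0))
    (hlap : ∀ x ≠ 0, -(lap w x) = b ‖x‖ * w x) {l : ℕ} {p : MvPolynomial (Fin N) ℝ}
    (hp : p ∈ harmonicSubmodule (Fin N) l) {g : ℝ → ℝ} (hg : ContDiff ℝ 2 g)
    (hgc : HasCompactSupport g) (hgU : tsupport g ⊆ Ioi 0) :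
    ∫ r in Ioi (0 : ℝ), r ^ (N - 1 + l) * sphereProj w p r *
      (deriv (deriv g) r + (N - 1 + 2 * l) / r * deriv g r + b r * g r) = 0 := by
  have hΦ := contDiff_radPoly hg hgU p
  have hΦc := hasCompactSupport_radPoly hgc p
  have hΦU : tsupport (radPoly g p) ⊆ {x | x ≠ 0} := fun x hx =>
    norm_pos_iff.1 (hgU (tsupport_radPoly_subset g p hx))
  set K : ℝ → ℝ := fun r => deriv (deriv g) r + (N - 1 + 2 * l) / r * deriv g r + b r * g r with hK
  have hae : ∀ᵐ x : EuclideanSpace ℝ (Fin N), x ≠ 0 := by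
    simp [ae_iff]
  have hnorm : ContinuousOn (fun x : EuclideanSpace ℝ (Fin N) => b ‖x‖) {x | x ≠ 0} :=
    hb.comp continuous_norm.continuousOn fun x hx => norm_pos_iff.2 hx
  have hlapΦ : Continuous (lap (radPoly g p)) := by
    refine continuous_finsetSum _ fun j _ => ?_
    have h1 : ContDiff ℝ 1 (fun x => fderiv ℝ (radPoly g p) x (EuclideanSpace.single j 1)) :=
      (hΦ.fderiv_right (by norm_num)).clm_apply contDiff_const
    exact (h1.continuous_fderiv one_ne_zero).clm_apply continuous_const
  have hsub : tsupport (lap (radPoly g p)) ⊆ tsupport (radPoly g p) := by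
    refine closure_minimal (fun x hx => ?_) (isClosed_tsupport _)
    by_contra hxn
    have hev : radPoly g p =ᶠ[𝓝 x] fun _ => 0 := notMem_tsupport_iff_eventuallyEq.1 hxn
    refine hx (Finset.sum_eq_zero fun j _ => ?_)
    have h2 : (fun y => fderiv ℝ (radPoly g p) y (EuclideanSpace.single j 1)) =ᶠ[𝓝 x]
        fun _ => 0 := by
      filter_upwards [hev.fderiv (𝕜 := ℝ)] with y hy
      simp [hy]
    simp [h2.fderiv_eq]
  have hi1 : Integrable fun x => w x * lap (radPoly g p) x :=
    integrable_mul_of_continuousOn isOpen_ne hw.continuousOn hlapΦ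
      (hΦc.mono' (subset_closure.trans hsub)) (hsub.trans hΦU)
  have hi2 : Integrable fun x => (b ‖x‖ * w x) * radPoly g p x :=
    integrable_mul_of_continuousOn isOpen_ne (hnorm.mul hw.continuousOn) hΦ.continuous hΦc hΦU
  have hsum : ∫ x, (w x * lap (radPoly g p) x + (b ‖x‖ * w x) * radPoly g p x) = 0 := by
    rw [integral_add hi1 hi2, integral_mul_lap isOpen_ne hw hΦ hΦc hΦU]
    have : ∫ x, b ‖x‖ * w x * radPoly g p x = ∫ x, -(lap w x * radPoly g p x) := by
      refine integral_congr_ae ?_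
      filter_upwards [hae] with x hx
      rw [← hlap x hx, neg_mul]
    rw [this, integral_neg, add_neg_cancel]
  have hcongr : ∀ᵐ x : EuclideanSpace ℝ (Fin N), w x * lap (radPoly g p) x +
      (b ‖x‖ * w x) * radPoly g p x = w x * radPoly K p x := by
    filter_upwards [hae] with x hx
    rw [lap_radPoly hg.contDiffOn hp hx]
    simp only [radPoly, hK]
    ring
  have hpol := (integrable_and_integral_polar ((hi1.add hi2).congr hcongr)).2
  rw [← integral_congr_ae hcongr, hsum] at hpol
  refine (setIntegral_congr_fun measurableSet_Ioi fun r hr => ?_).trans hpol.symm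
  have hr : 0 < r := hr
  have h3 : ∀ θ : Metric.sphere (0 : EuclideanSpace ℝ (Fin N)) 1,
      w (r • θ.1) * radPoly K p (r • θ.1) = (r ^ l * K r) * (w (r • θ.1) * eval θ.1.ofLp p) := by
    intro θ
    have : ‖r • θ.1‖ = r := by simp [norm_smul, abs_of_pos hr]
    rw [radPoly, this, IsHomogeneous_eval_smul hp.1]
    ring
  simp only [h3]
  rw [integral_const_mul, ← sphereProj, pow_add]
  ring

theorem continuousOn_deriv_and_hasDerivAt {f : ℝ → ℝ} (hf : ContDiffOn ℝ 2 f (Ioi 0)) :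
    ContinuousOn (deriv (deriv f)) (Ioi 0) ∧ ContinuousOn (deriv f) (Ioi 0) ∧
      (∀ r > 0, HasDerivAt f (deriv f r) r) ∧
        ∀ r > 0, HasDerivAt (deriv f) (deriv (deriv f) r) r := by
  have h1 : ContDiffOn ℝ 1 (deriv f) (Ioi 0) :=
    hf.deriv_of_isOpen isOpen_Ioi (by norm_num)
  exact ⟨h1.continuousOn_deriv_of_isOpen isOpen_Ioi le_rfl, h1.continuousOn,
    fun r hr => ((hf.differentiableOn two_ne_zero).differentiableAt
      (Ioi_mem_nhds hr)).hasDerivAt,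
    fun r hr => ((h1.differentiableOn one_ne_zero).differentiableAt
      (Ioi_mem_nhds hr)).hasDerivAt⟩

/-- Pairing a solution with a harmonic polynomial of degree `l` on spheres gives a solution of
the corresponding radial equation. -/
theorem sphereProj_ode [NeZero N] {w : EuclideanSpace ℝ (Fin N) → ℝ}
    (hw : ContDiffOn ℝ 2 w {x | x ≠ 0}) {b : ℝ → ℝ} (hb : ContinuousOn b (Ioi 0))
    (hlap : ∀ x ≠ 0, -(lap w x) = b ‖x‖ * w x) {l : ℕ} {p : MvPolynomial (Fin N) ℝ}
    (hp : p ∈ harmonicSubmodule (Fin N) l) {r : ℝ} (hr : 0 < r) :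
    deriv (deriv (sphereProj w p)) r + (N - 1) / r * deriv (sphereProj w p) r -
      l * (l + N - 2) / r ^ 2 * sphereProj w p r = -(b r * sphereProj w p r) := by
  have hψ := contDiffOn_sphereProj_two hw p
  set ψ := sphereProj w p with hψd
  obtain ⟨hc2, hc1, hd1, hd2⟩ := continuousOn_deriv_and_hasDerivAt hψ
  have hN : 1 ≤ N := NeZero.one_le
  have hNc : ((N - 1 : ℕ) : ℝ) = N - 1 := by push_cast [hN]; ring
  have hpow : ∀ (m : ℕ) (r : ℝ), 0 < r → HasDerivAt (fun r : ℝ => r ^ m) (m / r * r ^ m) r := by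
    intro m r hr
    refine (hasDerivAt_pow m r).congr_deriv ?_
    cases m with
    | zero => simp
    | succ m => simp only [Nat.add_sub_cancel]; field_simp; ring
  set P : ℝ → ℝ := fun r => r ^ (N - 1 + l) * (deriv ψ r - l / r * ψ r) with hP
  set Q : ℝ → ℝ := fun r => deriv (deriv ψ) r + (N - 1) / r * deriv ψ r -
    l * (l + N - 2) / r ^ 2 * ψ r with hQ
  have hPd : ∀ r > 0, HasDerivAt P (r ^ (N - 1 + l) * Q r) r := by
    intro r hr
    have h1 : HasDerivAt (fun r : ℝ => l / r) (-(l / r ^ 2)) r := by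
      have := (hasDerivAt_const r (l : ℝ)).fun_div (hasDerivAt_id' r) hr.ne'
      refine this.congr_deriv ?_
      ring
    refine ((hpow _ r hr).mul ((hd2 r hr).sub (h1.mul (hd1 r hr)))).congr_deriv ?_
    simp only [hQ, Pi.sub_apply, Pi.mul_apply]
    push_cast [hNc]
    field_simp
    ring
  have hQc : ContinuousOn Q (Ioi 0) := by
    have hne : ∀ r ∈ Ioi (0 : ℝ), r ≠ 0 := fun r hr => (mem_Ioi.1 hr).ne'
    refine (hc2.add ((continuousOn_const.div continuousOn_id hne).mul hc1)).sub
      ((continuousOn_const.div (continuousOn_id.pow 2) fun r hr => pow_ne_zero 2 (hne r hr)).mul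
        hψ.continuousOn)
  have hη : ∀ r > 0, HasDerivAt (fun r => ψ r / r ^ l) (P r / r ^ (N - 1 + 2 * l)) r := by
    intro r hr
    refine ((hd1 r hr).fun_div (hpow l r hr) (by positivity)).congr_deriv ?_
    simp only [hP]
    field_simp
    ring
  have hPη : ContinuousOn (fun r => P r / r ^ (N - 1 + 2 * l)) (Ioi 0) := by
    refine ContinuousOn.div (fun r hr => (hPd r hr).continuousAt.continuousWithinAt)
      (by fun_prop) fun r hr => ?_
    exact pow_ne_zero _ (mem_Ioi.1 hr).ne'
  have hzero : ∀ᵐ r : ℝ, r ∈ Ioi (0 : ℝ) → r ^ (N - 1 + l) * (Q r + b r * ψ r) = 0 := by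
    have hcont : ContinuousOn (fun r => r ^ (N - 1 + l) * (Q r + b r * ψ r)) (Ioi 0) :=
      ContinuousOn.mul (by fun_prop) (hQc.add (hb.mul hψ.continuousOn))
    refine isOpen_Ioi.ae_eq_zero_of_integral_contDiff_smul_eq_zero
      (hcont.locallyIntegrableOn measurableSet_Ioi) fun g hg hgc hgU => ?_
    have hg2 : ContDiff ℝ 2 g := contDiff_infty.1 hg 2
    have hg1 : ContDiff ℝ 1 (deriv g) := by
      have : ContDiff ℝ (1 + 1) g := by simpa [one_add_one_eq_two] using hg2
      exact (contDiff_succ_iff_deriv.1 this).2.2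
    have hweak := integral_sphereProj_weak hw hb hlap hp hg2 hgc hgU
    have hsub : tsupport (deriv g) ⊆ tsupport g :=
      closure_minimal support_deriv_subset (isClosed_tsupport g)
    have hgd : ∀ r, HasDerivAt g (deriv g r) r := fun r =>
      (hg2.differentiable two_ne_zero r).hasDerivAt
    have hgd2 : ∀ r, HasDerivAt (deriv g) (deriv (deriv g) r) r := fun r =>
      (hg1.differentiable one_ne_zero r).hasDerivAt
    set M := N - 1 + 2 * l with hM
    have hMc : (M : ℝ) = N - 1 + 2 * l := by rw [hM]; push_cast [hNc]; ring
    have hsubM : tsupport (fun r => r ^ M * deriv g r) ⊆ tsupport g :=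
      (closure_mono (Function.support_mul_subset_right _ _)).trans hsub
    have hsubM' : tsupport (fun r => M * r ^ (M - 1) * deriv g r + r ^ M * deriv (deriv g) r) ⊆
        tsupport g := by
      have : (fun r => M * r ^ (M - 1) * deriv g r + r ^ M * deriv (deriv g) r) =
          deriv (fun r => r ^ M * deriv g r) :=
        funext fun r => ((hasDerivAt_pow M r).fun_mul (hgd2 r)).deriv.symm
      rw [this]
      exact (closure_minimal support_deriv_subset (isClosed_tsupport _)).trans hsubM
    have ibp1 := setIntegral_Ioi_mul_deriv_of_tsupport_subset hη hPη
      (v := fun r => r ^ M * deriv g r)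
      (fun r => (hasDerivAt_pow M r).fun_mul (hgd2 r))
      (by have := hg1.continuous_deriv le_rfl; have := hg1.continuous; fun_prop)
      (hgc.mono' (subset_closure.trans hsubM)) (hsubM.trans hgU)
    have ibp2 := setIntegral_Ioi_mul_deriv_of_tsupport_subset hPd
      (ContinuousOn.mul (by fun_prop) hQc) hgd hg1.continuous hgc hgU
    have hi1 : IntegrableOn (fun r => r ^ (N - 1 + l) * Q r * g r) (Ioi 0) :=
      (integrable_mul_of_continuousOn isOpen_Ioi (ContinuousOn.mul (by fun_prop) hQc)
        hg.continuous hgc hgU).integrableOn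
    have hi2 : IntegrableOn (fun r => r ^ (N - 1 + l) * (b r * ψ r) * g r) (Ioi 0) :=
      (integrable_mul_of_continuousOn isOpen_Ioi
        (ContinuousOn.mul (by fun_prop) (hb.mul hψ.continuousOn))
        hg.continuous hgc hgU).integrableOn
    have hi3 : IntegrableOn (fun r => ψ r / r ^ l * (M * r ^ (M - 1) * deriv g r +
        r ^ M * deriv (deriv g) r)) (Ioi 0) := by
      refine (integrable_mul_of_continuousOn isOpen_Ioi
        (fun r hr => (hη r hr).continuousAt.continuousWithinAt)
        (by have := hg1.continuous_deriv le_rfl; have := hg1.continuous; fun_prop)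
        (hgc.mono' (subset_closure.trans hsubM')) (hsubM'.trans hgU)).integrableOn
    have e1 : ∫ r, g r • (r ^ (N - 1 + l) * (Q r + b r * ψ r)) = ∫ r in Ioi (0 : ℝ),
        (r ^ (N - 1 + l) * Q r * g r + r ^ (N - 1 + l) * (b r * ψ r) * g r) := by
      rw [← setIntegral_eq_integral_of_forall_compl_eq_zero (s := Ioi (0 : ℝ))]
      · refine setIntegral_congr_fun measurableSet_Ioi fun r _ => ?_
        simp only [smul_eq_mul]
        ring
      · intro r hr
        rw [image_eq_zero_of_notMem_tsupport fun h => hr (hgU h), zero_smul]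
    have e2 : ∫ r in Ioi (0 : ℝ), r ^ (N - 1 + l) * ψ r * (deriv (deriv g) r +
        (N - 1 + 2 * l) / r * deriv g r + b r * g r) = ∫ r in Ioi (0 : ℝ),
        (ψ r / r ^ l * (M * r ^ (M - 1) * deriv g r + r ^ M * deriv (deriv g) r) +
          r ^ (N - 1 + l) * (b r * ψ r) * g r) := by
      refine setIntegral_congr_fun measurableSet_Ioi fun r hr => ?_
      have hr : 0 < r := hr
      have h1 : M * r ^ (M - 1) = M / r * r ^ M := by
        have := (hasDerivAt_pow M r).unique (hpow M r hr)
        simpa using this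
      have h2 : r ^ M = r ^ (N - 1 + l) * r ^ l := by rw [hM, ← pow_add]; congr 1; ring
      rw [h1, h2, hMc]
      field_simp
      ring
    have e3 : ∫ r in Ioi (0 : ℝ), P r / r ^ M * (r ^ M * deriv g r) =
        ∫ r in Ioi (0 : ℝ), P r * deriv g r := by
      refine setIntegral_congr_fun measurableSet_Ioi fun r hr => ?_
      have hr : 0 < r := hr
      field_simp
    rw [e2, integral_add hi3 hi2, ibp1, e3, ibp2, neg_neg] at hweak
    rw [e1, integral_add hi1 hi2, hweak]
  have heq := Measure.eqOn_open_of_ae_eq (μ := volume)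
    ((ae_restrict_iff' measurableSet_Ioi).2 hzero) isOpen_Ioi
    (ContinuousOn.mul (by fun_prop) (hQc.add (hb.mul hψ.continuousOn))) continuousOn_const
  have := (mul_eq_zero.1 (heq hr)).resolve_left (pow_ne_zero _ hr.ne')
  exact eq_neg_of_add_eq_zero_left this

end SphericalProjectionODE

section WeightedODE

theorem integrableOn_Ioi_of_abs_le {f g : ℝ → ℝ} (hf : ContinuousOn f (Ioi 0))
    (hg : IntegrableOn g (Ioi 0)) (h : ∀ t > 0, |f t| ≤ g t) : IntegrableOn f (Ioi 0) :=
  Integrable.mono' hg (hf.aestronglyMeasurable measurableSet_Ioi)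
    ((ae_restrict_iff' measurableSet_Ioi).2 (Eventually.of_forall h))

theorem setIntegral_Ioi_pos {f : ℝ → ℝ} (hf : ContinuousOn f (Ioi 0))
    (hi : IntegrableOn f (Ioi 0)) (h0 : ∀ t > 0, 0 ≤ f t) {s : ℝ} (hs : 0 < s) (hfs : f s ≠ 0) :
    0 < ∫ t in Ioi (0 : ℝ), f t := by
  have hae : 0 ≤ᵐ[volume.restrict (Ioi 0)] f :=
    (ae_restrict_iff' measurableSet_Ioi).2 (Eventually.of_forall h0)
  refine lt_of_le_of_ne (integral_nonneg_of_ae hae) fun h => hfs ?_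
  have := (integral_eq_zero_iff_of_nonneg_ae hae hi).1 h.symm
  exact Measure.eqOn_open_of_ae_eq this isOpen_Ioi hf continuousOn_const hs

/-- A derivative on `(0, ∞)` has zero integral if there are no boundary contributions, as
measured by the scale-invariant integral of the function. -/
theorem setIntegral_Ioi_deriv_eq_zero {f f' : ℝ → ℝ} (hf : ∀ t > 0, HasDerivAt f (f' t) t)
    (hf' : IntegrableOn f' (Ioi 0)) (hft : IntegrableOn (fun t => f t / t) (Ioi 0)) :
    ∫ t in Ioi (0 : ℝ), f' t = 0 := by
  have himg : Real.exp '' univ = Ioi 0 := by rw [image_univ, Real.range_exp]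
  have hd : ∀ x ∈ (univ : Set ℝ), HasDerivWithinAt Real.exp (Real.exp x) univ x :=
    fun x _ => (Real.hasDerivAt_exp x).hasDerivWithinAt
  have hinj : InjOn Real.exp univ := Real.exp_injective.injOn
  rw [← himg, integral_image_eq_integral_abs_deriv_smul MeasurableSet.univ hd hinj,
    Measure.restrict_univ]
  rw [← himg, integrableOn_image_iff_integrableOn_abs_deriv_smul MeasurableSet.univ hd hinj,
    integrableOn_univ] at hf' hft
  simp only [Real.abs_exp, smul_eq_mul] at hf' hft ⊢
  refine integral_eq_zero_of_hasDerivAt_of_integrable (f := fun x => f (Real.exp x))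
    (fun x => ?_) hf' ?_
  · rw [mul_comm]
    exact (hf _ (Real.exp_pos x)).comp x (Real.hasDerivAt_exp x)
  · refine hft.congr (Eventually.of_forall fun x => ?_)
    have := (Real.exp_pos x).ne'
    dsimp only
    field_simp

theorem hasDerivAt_rpow_weight (k : ℝ) {t : ℝ} (ht : 0 < t) :
    HasDerivAt (fun t : ℝ => t ^ k) (k * (t ^ k / t)) t := by
  refine (Real.hasDerivAt_rpow_const (Or.inl ht.ne')).congr_deriv ?_
  rw [Real.rpow_sub_one ht.ne']

theorem continuousOn_rpow_weight (k : ℝ) : ContinuousOn (fun t : ℝ => t ^ k) (Ioi 0) :=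
  fun _ ht => (hasDerivAt_rpow_weight k ht).continuousAt.continuousWithinAt

section MemE

variable {k : ℝ} {φ ψ : ℝ → ℝ}

theorem memE.continuousOn (h : memE k ψ) : ContinuousOn ψ (Ioi 0) := h.1.continuousOn

theorem memE.continuousOn_deriv (h : memE k ψ) : ContinuousOn (deriv ψ) (Ioi 0) :=
  h.1.continuousOn_deriv_of_isOpen isOpen_Ioi le_rfl

theorem memE.hasDerivAt (h : memE k ψ) {t : ℝ} (ht : 0 < t) : HasDerivAt ψ (deriv ψ t) t :=
  ((h.1.differentiableOn one_ne_zero).differentiableAt (Ioi_mem_nhds ht)).hasDerivAt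

theorem memE.integrableOn_sq (h : memE k ψ) : IntegrableOn (fun t => t ^ k * ψ t ^ 2) (Ioi 0) := by
  refine integrableOn_Ioi_of_abs_le ((continuousOn_rpow_weight k).mul (h.continuousOn.pow 2)) h.2
    fun t ht => ?_
  rw [abs_of_nonneg (by positivity)]
  gcongr
  nlinarith [sq_nonneg (deriv ψ t)]

theorem memE.integrableOn_deriv_sq (h : memE k ψ) :
    IntegrableOn (fun t => t ^ k * deriv ψ t ^ 2) (Ioi 0) := by
  refine integrableOn_Ioi_of_abs_le ((continuousOn_rpow_weight k).mul (h.continuousOn_deriv.pow 2))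
    h.2 fun t ht => ?_
  rw [abs_of_nonneg (by positivity)]
  gcongr
  nlinarith [sq_nonneg (ψ t)]

theorem memE.const_mul_add (hφ : memE k φ) (hψ : memE k ψ) (a b : ℝ) :
    memE k (fun t => a * φ t + b * ψ t) ∧
      ∀ t > 0, deriv (fun t => a * φ t + b * ψ t) t = a * deriv φ t + b * deriv ψ t := by
  have hd : ∀ t > 0, deriv (fun t => a * φ t + b * ψ t) t = a * deriv φ t + b * deriv ψ t :=
    fun t ht => (((hφ.hasDerivAt ht).const_mul a).add ((hψ.hasDerivAt ht).const_mul b)).deriv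
  have hc : ContDiffOn ℝ 1 (fun t => a * φ t + b * ψ t) (Ioi 0) :=
    (contDiffOn_const.mul hφ.1).add (contDiffOn_const.mul hψ.1)
  refine ⟨⟨hc, ?_⟩, hd⟩
  refine integrableOn_Ioi_of_abs_le ((continuousOn_rpow_weight k).mul
    (((hc.continuousOn_deriv_of_isOpen isOpen_Ioi le_rfl).pow 2).add (hc.continuousOn.pow 2)))
    ((hφ.2.const_mul (2 * a ^ 2)).add (hψ.2.const_mul (2 * b ^ 2))) fun t ht => ?_
  rw [abs_of_nonneg (by positivity), hd t ht, Pi.add_apply]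
  have h0 : 0 ≤ t ^ k := by positivity
  have : (a * deriv φ t + b * deriv ψ t) ^ 2 + (a * φ t + b * ψ t) ^ 2 ≤
      2 * a ^ 2 * (deriv φ t ^ 2 + φ t ^ 2) + 2 * b ^ 2 * (deriv ψ t ^ 2 + ψ t ^ 2) := by
    nlinarith [sq_nonneg (a * deriv φ t - b * deriv ψ t), sq_nonneg (a * φ t - b * ψ t)]
  calc _ ≤ t ^ k * _ := mul_le_mul_of_nonneg_left this h0
    _ = _ := by ring

/-- Hardy's inequality, in qualitative form. -/
theorem memE.hardy (hk : 1 < k) (h : memE k ψ) :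
    IntegrableOn (fun t => t ^ k / t ^ 2 * ψ t ^ 2) (Ioi 0) := by
  have hne : ∀ t ∈ Ioi (0 : ℝ), t ≠ 0 := fun t ht => (mem_Ioi.1 ht).ne'
  have hcont : ContinuousOn (fun t => t ^ k / t ^ 2 * ψ t ^ 2) (Ioi 0) :=
    ((continuousOn_rpow_weight k).div (continuousOn_id.pow 2) fun t ht =>
      pow_ne_zero 2 (hne t ht)).mul (h.continuousOn.pow 2)
  have hk' : 0 < k - 1 := by linarith
  set D : ℝ → ℝ := fun t => (k - 1) * (t ^ k / t ^ 2 * ψ t ^ 2) +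
    2 * (t ^ k / t * (ψ t * deriv ψ t)) with hD
  have hDc : ContinuousOn D (Ioi 0) := by
    refine (continuousOn_const.mul hcont).add (continuousOn_const.mul
      (((continuousOn_rpow_weight k).div continuousOn_id hne).mul
        (h.continuousOn.mul h.continuousOn_deriv)))
  have hGd : ∀ t > 0, HasDerivAt (fun t => t ^ k / t * ψ t ^ 2) (D t) t := by
    intro t ht
    refine (((hasDerivAt_rpow_weight k ht).fun_div (hasDerivAt_id' t) ht.ne').fun_mul
      ((h.hasDerivAt ht).fun_pow 2)).congr_deriv ?_
    simp only [hD]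
    field_simp
    push_cast
    ring
  have hsplit : Ioi (0 : ℝ) = Ioc 0 1 ∪ Ioi 1 := (Ioc_union_Ioi_eq_Ioi zero_le_one).symm
  rw [hsplit, integrableOn_union]
  constructor
  · refine integrableOn_Ioc_of_intervalIntegral_norm_bounded_left (l := atTop)
      (a := fun n : ℕ => 1 / ((n : ℝ) + 1))
      (I := 2 / (k - 1) * ((1 : ℝ) ^ k / 1 * ψ 1 ^ 2 +
        2 / (k - 1) * ∫ t in Ioi (0 : ℝ), t ^ k * deriv ψ t ^ 2))
      ?_ tendsto_one_div_add_atTop_nhds_zero_nat (Eventually.of_forall fun n => ?_)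
    · intro n
      have h0 : (0 : ℝ) < 1 / ((n : ℝ) + 1) := by positivity
      refine ((hcont.mono fun t ht => ?_).integrableOn_Icc).mono_set Ioc_subset_Icc_self
      exact h0.trans_le ht.1
    · set a : ℝ := 1 / ((n : ℝ) + 1) with ha
      have h0 : 0 < a := by positivity
      have h1 : a ≤ 1 := by
        rw [ha, div_le_one (by positivity)]
        linarith [(Nat.cast_nonneg n : (0 : ℝ) ≤ n)]
      have hIcc : uIcc a 1 ⊆ Ioi 0 := by
        rw [uIcc_of_le h1]
        exact fun t ht => h0.trans_le ht.1
      have hIoc : Ioc a 1 ⊆ Ioi 0 := fun t ht => h0.trans ht.1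
      have hftc := intervalIntegral.integral_eq_sub_of_hasDerivAt
        (fun t ht => hGd t (hIcc ht)) (hDc.mono hIcc).intervalIntegrable
      rw [intervalIntegral.integral_of_le h1] at hftc
      have hDi : IntegrableOn D (Ioc a 1) :=
        (hDc.mono hIcc).intervalIntegrable.1
      have hEi : IntegrableOn (fun t => 2 / (k - 1) * (t ^ k * deriv ψ t ^ 2)) (Ioi 0) :=
        h.integrableOn_deriv_sq.const_mul _
      have hmono : ∫ t in Ioc a 1, (k - 1) / 2 * ‖t ^ k / t ^ 2 * ψ t ^ 2‖ ≤
          ∫ t in Ioc a 1, (D t + 2 / (k - 1) * (t ^ k * deriv ψ t ^ 2)) := by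
        refine setIntegral_mono_on ?_ (hDi.add (hEi.mono_set hIoc)) measurableSet_Ioc
          fun t ht => ?_
        · exact (((hcont.mono hIcc).intervalIntegrable.1).norm).const_mul _
        · have ht0 : 0 < t := hIoc ht
          have hp : 0 < t ^ k := by positivity
          rw [Real.norm_of_nonneg (by positivity), hD]
          have : D t + 2 / (k - 1) * (t ^ k * deriv ψ t ^ 2) -
              (k - 1) / 2 * (t ^ k / t ^ 2 * ψ t ^ 2) =
              t ^ k * (((k - 1) * (ψ t / t) + 2 * deriv ψ t) ^ 2 / (2 * (k - 1))) := by
            simp only [hD]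
            field_simp
            ring
          have h2 : 0 ≤ t ^ k * (((k - 1) * (ψ t / t) + 2 * deriv ψ t) ^ 2 / (2 * (k - 1))) := by
            positivity
          simp only [hD] at this
          linarith
      rw [integral_add hDi (hEi.mono_set hIoc), integral_const_mul,
        hftc] at hmono
      have hle : ∫ t in Ioc a 1, 2 / (k - 1) * (t ^ k * deriv ψ t ^ 2) ≤
          2 / (k - 1) * ∫ t in Ioi (0 : ℝ), t ^ k * deriv ψ t ^ 2 := by
        rw [← integral_const_mul]
        refine setIntegral_mono_set hEi ?_ hIoc.eventuallyLE
        refine (ae_restrict_iff' measurableSet_Ioi).2 (Eventually.of_forall fun t ht => ?_)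
        have : 0 < t := ht
        simp only [Pi.zero_apply]
        positivity
      have hGa : 0 ≤ a ^ k / a * ψ a ^ 2 := by positivity
      have hfin : (k - 1) / 2 * ∫ t in Ioc a 1, ‖t ^ k / t ^ 2 * ψ t ^ 2‖ ≤
          (1 : ℝ) ^ k / 1 * ψ 1 ^ 2 + 2 / (k - 1) * ∫ t in Ioi (0 : ℝ), t ^ k * deriv ψ t ^ 2 := by
        linarith
      rw [div_mul_eq_mul_div, le_div_iff₀ hk']
      linarith
  · refine Integrable.mono' (h.integrableOn_sq.mono_set (Ioi_subset_Ioi zero_le_one))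
      ((hcont.mono (Ioi_subset_Ioi zero_le_one)).aestronglyMeasurable measurableSet_Ioi)
      ((ae_restrict_iff' measurableSet_Ioi).2 (Eventually.of_forall fun t ht => ?_))
    have ht1 : 1 < t := ht
    have ht0 : 0 < t := by linarith
    rw [Real.norm_of_nonneg (by positivity)]
    gcongr
    exact div_le_self (by positivity) (by nlinarith)

theorem memE.integrableOn_mul (hφ : memE k φ) (hψ : memE k ψ) :
    IntegrableOn (fun t => t ^ k * (φ t * ψ t)) (Ioi 0) := by
  refine integrableOn_Ioi_of_abs_le ((continuousOn_rpow_weight k).mul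
    (hφ.continuousOn.mul hψ.continuousOn)) (hφ.integrableOn_sq.add hψ.integrableOn_sq)
      fun t ht => ?_
  rw [abs_mul, abs_of_nonneg (by positivity : 0 ≤ t ^ k), Pi.add_apply, ← mul_add]
  gcongr
  rw [abs_le]
  constructor <;> nlinarith [sq_nonneg (φ t + ψ t), sq_nonneg (φ t - ψ t)]

theorem memE.integrableOn_deriv_mul_deriv (hφ : memE k φ) (hψ : memE k ψ) :
    IntegrableOn (fun t => t ^ k * (deriv φ t * deriv ψ t)) (Ioi 0) := by
  refine integrableOn_Ioi_of_abs_le ((continuousOn_rpow_weight k).mul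
    (hφ.continuousOn_deriv.mul hψ.continuousOn_deriv))
    (hφ.integrableOn_deriv_sq.add hψ.integrableOn_deriv_sq) fun t ht => ?_
  rw [abs_mul, abs_of_nonneg (by positivity : 0 ≤ t ^ k), Pi.add_apply, ← mul_add]
  gcongr
  rw [abs_le]
  constructor <;> nlinarith [sq_nonneg (deriv φ t + deriv ψ t), sq_nonneg (deriv φ t - deriv ψ t)]

theorem continuousOn_hardy_weight (k : ℝ) : ContinuousOn (fun t : ℝ => t ^ k / t ^ 2) (Ioi 0) :=
  (continuousOn_rpow_weight k).div (continuousOn_id.pow 2) fun _ ht =>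
    pow_ne_zero 2 (mem_Ioi.1 ht).ne'

theorem memE.integrableOn_hardy_mul (hk : 1 < k) (hφ : memE k φ) (hψ : memE k ψ) :
    IntegrableOn (fun t => t ^ k / t ^ 2 * (φ t * ψ t)) (Ioi 0) := by
  refine integrableOn_Ioi_of_abs_le ((continuousOn_hardy_weight k).mul
    (hφ.continuousOn.mul hψ.continuousOn)) ((hφ.hardy hk).add (hψ.hardy hk)) fun t ht => ?_
  rw [abs_mul, abs_of_nonneg (by positivity : 0 ≤ t ^ k / t ^ 2), Pi.add_apply, ← mul_add]
  gcongr
  rw [abs_le]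
  constructor <;> nlinarith [sq_nonneg (φ t + ψ t), sq_nonneg (φ t - ψ t)]

end MemE

/-- A finite energy solution of the equation satisfied by the angular modes of the linearized
problem. -/
def ModeSol (k μ : ℝ) (A : ℝ → ℝ) (ψ : ℝ → ℝ) : Prop :=
  ContDiffOn ℝ 2 ψ (Ioi 0) ∧ memE k ψ ∧
  ∀ t > (0 : ℝ), -(deriv (deriv ψ) t) - k / t * deriv ψ t + μ / t ^ 2 * ψ t = A t * ψ t

section ModeSol

variable {k μ ν C : ℝ} {A φ ψ : ℝ → ℝ}

theorem integrableOn_weight_mul (hA : ContinuousOn A (Ioi 0)) (hAC : ∀ t > 0, |A t| ≤ C)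
    (hφ : memE k φ) (hψ : memE k ψ) :
    IntegrableOn (fun t => t ^ k * (A t * (φ t * ψ t))) (Ioi 0) := by
  refine integrableOn_Ioi_of_abs_le ((continuousOn_rpow_weight k).mul
    (hA.mul (hφ.continuousOn.mul hψ.continuousOn))) ((hφ.integrableOn_mul hψ).abs.const_mul C)
    fun t ht => ?_
  rw [abs_mul, abs_mul (A t), abs_mul (t ^ k), mul_left_comm]
  exact mul_le_mul_of_nonneg_right (hAC t ht) (by positivity)

theorem ModeSol.pairing (hk : 1 < k) (hA : ContinuousOn A (Ioi 0)) (hAC : ∀ t > 0, |A t| ≤ C)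
    (hφ : ModeSol k μ A φ) (hψ : memE k ψ) :
    ∫ t in Ioi (0 : ℝ), t ^ k * (deriv φ t * deriv ψ t - A t * (φ t * ψ t)) =
      -(μ * ∫ t in Ioi (0 : ℝ), t ^ k / t ^ 2 * (φ t * ψ t)) := by
  have hi1 := hφ.2.1.integrableOn_deriv_mul_deriv hψ
  have hi2 := integrableOn_weight_mul hA hAC hφ.2.1 hψ
  have hi3 := hφ.2.1.integrableOn_hardy_mul hk hψ
  have hdiv : IntegrableOn (fun t => t ^ k * (deriv φ t * ψ t) / t) (Ioi 0) := by
    refine integrableOn_Ioi_of_abs_le (((continuousOn_rpow_weight k).mul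
      (hφ.2.1.continuousOn_deriv.mul hψ.continuousOn)).div continuousOn_id
      fun t ht => (mem_Ioi.1 ht).ne') (hφ.2.1.integrableOn_deriv_sq.add (hψ.hardy hk))
      fun t ht => ?_
    have h1 : t ^ k * (deriv φ t * ψ t) / t = t ^ k * (deriv φ t * (ψ t / t)) := by ring
    have h2 : t ^ k / t ^ 2 * ψ t ^ 2 = t ^ k * (ψ t / t) ^ 2 := by ring
    rw [Pi.add_apply, h1, h2, abs_mul, abs_of_nonneg (by positivity : 0 ≤ t ^ k), ← mul_add]
    gcongr
    rw [abs_le]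
    constructor <;> nlinarith [sq_nonneg (deriv φ t + ψ t / t), sq_nonneg (deriv φ t - ψ t / t)]
  have hsum : IntegrableOn (fun t => t ^ k * (deriv φ t * deriv ψ t - A t * (φ t * ψ t)) +
      μ * (t ^ k / t ^ 2 * (φ t * ψ t))) (Ioi 0) := by
    simp only [mul_sub]
    exact (hi1.sub hi2).add (hi3.const_mul μ)
  have h0 := setIntegral_Ioi_deriv_eq_zero (f := fun t => t ^ k * (deriv φ t * ψ t))
    (fun t ht => ?_) hsum hdiv
  · rw [integral_add _ (hi3.const_mul μ), integral_const_mul] at h0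
    · linarith
    · simp only [mul_sub]
      exact hi1.sub hi2
  · have hd2 : HasDerivAt (deriv φ) (deriv (deriv φ) t) t :=
      (((hφ.1.deriv_of_isOpen isOpen_Ioi (m := 1) (by norm_num)).differentiableOn
        one_ne_zero).differentiableAt (Ioi_mem_nhds ht)).hasDerivAt
    refine ((hasDerivAt_rpow_weight k ht).fun_mul
      (hd2.fun_mul (hψ.hasDerivAt ht))).congr_deriv ?_
    have hode := hφ.2.2 t ht
    have : deriv (deriv φ) t = -(k / t * deriv φ t) + μ / t ^ 2 * φ t - A t * φ t := by linarith
    rw [this]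
    ring

/-- If two functions span a plane on which the quadratic form is negative definite, the Morse
index cannot be one. -/
theorem MorseIndexOne.exists_relation (hm : MorseIndexOne k A) (hφ : memE k φ) (hψ : memE k ψ)
    (hneg : ∀ a b : ℝ, (∃ t > 0, a * φ t + b * ψ t ≠ 0) →
      ∫ t in Ioi (0 : ℝ), t ^ k * (deriv (fun t => a * φ t + b * ψ t) t ^ 2 -
        A t * (a * φ t + b * ψ t) ^ 2) < 0) :
    ∃ a b : ℝ, ¬(a = 0 ∧ b = 0) ∧ ∀ t > 0, a * φ t + b * ψ t = 0 := by
  by_contra! hcon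
  have hind : ∀ c₁ c₂ : ℝ, (∀ t ∈ Ioi (0 : ℝ), c₁ * φ t + c₂ * ψ t = 0) → c₁ = 0 ∧ c₂ = 0 := by
    intro a b hab
    by_contra h
    obtain ⟨t, ht, hne⟩ := hcon a b (fun h1 h2 => h ⟨h1, h2⟩)
    exact hne (hab t ht)
  obtain ⟨a, b, hab, hR⟩ := hm.2 φ ψ hφ hψ hind
  obtain ⟨t, ht, hne⟩ := hcon a b (fun h1 h2 => hab ⟨h1, h2⟩)
  have hmem := (hφ.const_mul_add hψ a b).1
  have hnum := hneg a b ⟨t, ht, hne⟩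
  have hden : 0 < ∫ t in Ioi (0 : ℝ), t ^ k * (a * φ t + b * ψ t) ^ 2 :=
    setIntegral_Ioi_pos ((continuousOn_rpow_weight k).mul (hmem.continuousOn.pow 2))
      hmem.integrableOn_sq (fun t ht => by positivity) ht
      (mul_ne_zero (Real.rpow_pos_of_pos ht k).ne' (pow_ne_zero 2 hne))
  exact absurd hR (not_le.2 (div_neg_of_neg_of_pos hnum hden))

theorem hardy_integral_pos (hk : 1 < k) (hφ : memE k φ) {t : ℝ} (ht : 0 < t) (hne : φ t ≠ 0) :
    0 < ∫ t in Ioi (0 : ℝ), t ^ k / t ^ 2 * (φ t * φ t) := by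
  have hc := (continuousOn_hardy_weight k).mul (hφ.continuousOn.mul hφ.continuousOn)
  refine setIntegral_Ioi_pos hc (hφ.integrableOn_hardy_mul hk hφ) (fun t ht => ?_) ht ?_
  · have := mul_self_nonneg (φ t)
    positivity
  · have : 0 < t ^ k / t ^ 2 := by positivity
    exact mul_ne_zero this.ne' (mul_self_ne_zero.2 hne)

theorem ModeSol.const_mul_add (hφ : ModeSol k μ A φ) (hψ : ModeSol k μ A ψ) (a b : ℝ) :
    ModeSol k μ A (fun t => a * φ t + b * ψ t) := by
  obtain ⟨hm, hd⟩ := hφ.2.1.const_mul_add hψ.2.1 a b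
  refine ⟨(contDiffOn_const.mul hφ.1).add (contDiffOn_const.mul hψ.1), hm, fun t ht => ?_⟩
  have hev : deriv (fun t => a * φ t + b * ψ t) =ᶠ[𝓝 t] fun t => a * deriv φ t + b * deriv ψ t := by
    filter_upwards [Ioi_mem_nhds ht] with s hs using hd s hs
  have hdd : ∀ {φ : ℝ → ℝ}, ModeSol k μ A φ → HasDerivAt (deriv φ) (deriv (deriv φ) t) t :=
    fun hφ => (((hφ.1.deriv_of_isOpen isOpen_Ioi (m := 1) (by norm_num)).differentiableOn
      one_ne_zero).differentiableAt (Ioi_mem_nhds ht)).hasDerivAt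
  rw [hev.deriv_eq, hd t ht, (((hdd hφ).const_mul a).fun_add ((hdd hψ).const_mul b)).deriv]
  linear_combination a * hφ.2.2 t ht + b * hψ.2.2 t ht

theorem ModeSol.orthogonal (hk : 1 < k) (hA : ContinuousOn A (Ioi 0))
    (hAC : ∀ t > 0, |A t| ≤ C) (hφ : ModeSol k μ A φ) (hψ : ModeSol k ν A ψ) (h : μ ≠ ν) :
    ∫ t in Ioi (0 : ℝ), t ^ k / t ^ 2 * (φ t * ψ t) = 0 := by
  have h1 := hφ.pairing hk hA hAC hψ.2.1
  have h2 := hψ.pairing hk hA hAC hφ.2.1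
  simp only [mul_comm (ψ _), mul_comm (deriv ψ _)] at h2
  have : (μ - ν) * ∫ t in Ioi (0 : ℝ), t ^ k / t ^ 2 * (φ t * ψ t) = 0 := by linarith
  exact (mul_eq_zero.1 this).resolve_left (sub_ne_zero.2 h)

/-- Under Morse index one, there is at most one positive angular eigenvalue with nontrivial
modes, and these are proportional. -/
theorem ModeSol.exists_relation (hk : 1 < k) (hA : ContinuousOn A (Ioi 0))
    (hAC : ∀ t > 0, |A t| ≤ C) (hm : MorseIndexOne k A) (hμ : 0 < μ) (hν : 0 < ν)
    (hφ : ModeSol k μ A φ) (hψ : ModeSol k ν A ψ) :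
    ∃ a b : ℝ, ¬(a = 0 ∧ b = 0) ∧ (∀ t > 0, a * φ t + b * ψ t = 0) := by
  refine hm.exists_relation hφ.2.1 hψ.2.1 fun a b hab => ?_
  obtain ⟨t, ht, hne⟩ := hab
  by_cases h : μ = ν
  · subst h
    have hs := hφ.const_mul_add hψ a b
    have hp := hs.pairing hk hA hAC hs.2.1
    simp only [← pow_two] at hp
    rw [hp]
    have := hardy_integral_pos hk hs.2.1 ht hne
    simp only [← pow_two] at this
    exact neg_neg_of_pos (mul_pos hμ this)
  · have hd := (hφ.2.1.const_mul_add hψ.2.1 a b).2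
    have hi : ∀ {φ ψ : ℝ → ℝ}, memE k φ → memE k ψ → IntegrableOn
        (fun t => t ^ k * (deriv φ t * deriv ψ t - A t * (φ t * ψ t))) (Ioi 0) := by
      intro φ ψ hφ hψ
      simp only [mul_sub]
      exact (hφ.integrableOn_deriv_mul_deriv hψ).sub (integrableOn_weight_mul hA hAC hφ hψ)
    have hexp : ∫ t in Ioi (0 : ℝ), t ^ k * (deriv (fun t => a * φ t + b * ψ t) t ^ 2 -
        A t * (a * φ t + b * ψ t) ^ 2) = ∫ t in Ioi (0 : ℝ),
        (a ^ 2 * (t ^ k * (deriv φ t * deriv φ t - A t * (φ t * φ t))) +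
        2 * a * b * (t ^ k * (deriv φ t * deriv ψ t - A t * (φ t * ψ t))) +
        b ^ 2 * (t ^ k * (deriv ψ t * deriv ψ t - A t * (ψ t * ψ t)))) := by
      refine setIntegral_congr_fun measurableSet_Ioi fun t ht => ?_
      simp only [hd t ht]
      ring
    have i1 := (hi hφ.2.1 hφ.2.1).const_mul (a ^ 2)
    have i2 := (hi hφ.2.1 hψ.2.1).const_mul (2 * a * b)
    have i3 := (hi hψ.2.1 hψ.2.1).const_mul (b ^ 2)
    have i12 : IntegrableOn (fun t =>
        a ^ 2 * (t ^ k * (deriv φ t * deriv φ t - A t * (φ t * φ t))) +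
        2 * a * b * (t ^ k * (deriv φ t * deriv ψ t - A t * (φ t * ψ t)))) (Ioi 0) := i1.add i2
    rw [hexp, integral_add i12 i3, integral_add i1 i2, integral_const_mul,
      integral_const_mul, integral_const_mul, hφ.pairing hk hA hAC hφ.2.1,
      hφ.pairing hk hA hAC hψ.2.1, hψ.pairing hk hA hAC hψ.2.1, hφ.orthogonal hk hA hAC hψ h]
    have hnn : ∀ {φ : ℝ → ℝ}, 0 ≤ ∫ t in Ioi (0 : ℝ), t ^ k / t ^ 2 * (φ t * φ t) := by
      intro φ
      refine setIntegral_nonneg measurableSet_Ioi fun t ht => ?_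
      have ht : 0 < t := ht
      have := mul_self_nonneg (φ t)
      positivity
    have h1 : 0 ≤ a ^ 2 * (μ * ∫ t in Ioi (0 : ℝ), t ^ k / t ^ 2 * (φ t * φ t)) :=
      mul_nonneg (sq_nonneg a) (mul_nonneg hμ.le hnn)
    have h2 : 0 ≤ b ^ 2 * (ν * ∫ t in Ioi (0 : ℝ), t ^ k / t ^ 2 * (ψ t * ψ t)) :=
      mul_nonneg (sq_nonneg b) (mul_nonneg hν.le hnn)
    by_cases haφ : a * φ t = 0
    · have hbψ : b * ψ t ≠ 0 := fun h => hne (by rw [haφ, h, add_zero])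
      have := mul_pos (pow_pos (abs_pos.2 (left_ne_zero_of_mul hbψ)) 2)
        (mul_pos hν (hardy_integral_pos hk hψ.2.1 ht (right_ne_zero_of_mul hbψ)))
      rw [sq_abs] at this
      linarith
    · have := mul_pos (pow_pos (abs_pos.2 (left_ne_zero_of_mul haφ)) 2)
        (mul_pos hμ (hardy_integral_pos hk hφ.2.1 ht (right_ne_zero_of_mul haφ)))
      rw [sq_abs] at this
      linarith

theorem ModeSol.eq_const_mul (hk : 1 < k) (hA : ContinuousOn A (Ioi 0))
    (hAC : ∀ t > 0, |A t| ≤ C) (hm : MorseIndexOne k A) (hμ : 0 < μ) (hν : 0 < ν)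
    (hφ : ModeSol k μ A φ) (hψ : ModeSol k ν A ψ) {s : ℝ} (hs : 0 < s) (hψs : ψ s ≠ 0) :
    ∃ c : ℝ, (∀ t > 0, φ t = c * ψ t) ∧ (μ ≠ ν → c = 0) := by
  obtain ⟨a, b, hab, h⟩ := hφ.exists_relation hk hA hAC hm hμ hν hψ
  have ha : a ≠ 0 := by
    rintro rfl
    have := h s hs
    rw [zero_mul, zero_add] at this
    exact hab ⟨rfl, (mul_eq_zero.1 this).resolve_right hψs⟩
  have hc : ∀ t > 0, φ t = -(b / a) * ψ t := by
    intro t ht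
    have := h t ht
    field_simp
    linarith
  refine ⟨-(b / a), hc, fun hne => ?_⟩
  have ho := hφ.orthogonal hk hA hAC hψ hne
  have hcongr : ∫ t in Ioi (0 : ℝ), t ^ k / t ^ 2 * (φ t * ψ t) =
      ∫ t in Ioi (0 : ℝ), -(b / a) * (t ^ k / t ^ 2 * (ψ t * ψ t)) := by
    refine setIntegral_congr_fun measurableSet_Ioi fun t ht => ?_
    rw [hc t ht]
    ring
  rw [hcongr, integral_const_mul] at ho
  exact (mul_eq_zero.1 ho).resolve_right (hardy_integral_pos hk hψ.2.1 hs hψs).ne'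

end ModeSol

end WeightedODE

section Profile

variable {k : ℝ} {F V : ℝ → ℝ}

theorem exists_abs_le_of_tendsto (hV : ContDiffOn ℝ 2 V (Ioi 0))
    (hV0 : Tendsto (deriv V) (𝓝[>] 0) (𝓝 0)) (hVinf : Tendsto V atTop (𝓝 0)) :
    ∃ M, ∀ t > 0, |V t| ≤ M := by
  obtain ⟨δ, hδ, h1⟩ : ∃ δ > 0, ∀ t ∈ Ioo (0 : ℝ) δ, |deriv V t| ≤ 1 := by
    have h := hV0.abs.eventually_le_const (by simp : |(0 : ℝ)| < 1)
    obtain ⟨δ, hδ, h⟩ := mem_nhdsGT_iff_exists_Ioo_subset.1 h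
    exact ⟨δ, hδ, fun t ht => h ht⟩
  obtain ⟨T, hT⟩ : ∃ T, ∀ t ≥ T, |V t| ≤ 1 :=
    eventually_atTop.1 (hVinf.abs.eventually_le_const (by simp : |(0 : ℝ)| < 1))
  have hsub : Icc (δ / 2) T ⊆ Ioi 0 := fun t ht => (half_pos hδ).trans_le ht.1
  obtain ⟨B, hB⟩ := isCompact_Icc.exists_bound_of_continuousOn (hV.continuousOn.mono hsub)
  refine ⟨max (|V (δ / 2)| + δ) (max B 1), fun t ht => ?_⟩
  rcases lt_or_ge t δ with h | h
  · refine le_max_of_le_left ?_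
    have hm : δ / 2 ∈ Ioo (0 : ℝ) δ := ⟨half_pos hδ, half_lt_self hδ⟩
    have := (convex_Ioo (0 : ℝ) δ).norm_image_sub_le_of_norm_deriv_le (f := V) (C := 1)
      (fun s hs => (hV.differentiableOn two_ne_zero).differentiableAt (Ioi_mem_nhds hs.1))
      (fun s hs => h1 s hs) hm ⟨ht, h⟩
    rw [Real.norm_eq_abs, Real.norm_eq_abs, one_mul] at this
    have h3 : |t - δ / 2| ≤ δ := abs_le.2 ⟨by linarith, by linarith⟩
    have h4 := abs_sub_abs_le_abs_sub (V t) (V (δ / 2))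
    linarith
  · refine le_max_of_le_right ?_
    rcases le_or_gt T t with h' | h'
    · exact le_max_of_le_right (hT t h')
    · exact le_max_of_le_left (hB t ⟨by linarith, h'.le⟩)

theorem exists_abs_deriv_comp_le (hF : ContDiff ℝ 1 F) (hV : ContDiffOn ℝ 2 V (Ioi 0))
    (hV0 : Tendsto (deriv V) (𝓝[>] 0) (𝓝 0)) (hVinf : Tendsto V atTop (𝓝 0)) :
    ∃ C, ∀ t > 0, |deriv F (V t)| ≤ C := by
  obtain ⟨M, hM⟩ := exists_abs_le_of_tendsto hV hV0 hVinf
  obtain ⟨C, hC⟩ := (isCompact_Icc (a := -M) (b := M)).exists_bound_of_continuousOn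
    (hF.continuous_deriv le_rfl).continuousOn
  exact ⟨C, fun t ht => hC _ (abs_le.1 (hM t ht))⟩

theorem exists_deriv_ne_zero_of_tendsto (hV : ContDiffOn ℝ 2 V (Ioi 0))
    (hVpos : ∀ t > 0, 0 < V t) (hVinf : Tendsto V atTop (𝓝 0)) : ∃ t > 0, deriv V t ≠ 0 := by
  by_contra! h
  have hc : ∀ t > 0, V t = V 1 := fun t ht =>
    isOpen_Ioi.is_const_of_deriv_eq_zero isPreconnected_Ioi (hV.differentiableOn two_ne_zero)
      (fun s hs => h s hs) ht (mem_Ioi.2 one_pos)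
  have : Tendsto V atTop (𝓝 (V 1)) :=
    tendsto_const_nhds.congr' ((eventually_gt_atTop 0).mono fun t ht => (hc t ht).symm)
  exact (hVpos 1 one_pos).ne' (tendsto_nhds_unique this hVinf)

theorem modeSol_deriv (hF : ContDiff ℝ 1 F) (hV : ContDiffOn ℝ 2 V (Ioi 0))
    (hode : ∀ t > 0, -(deriv (deriv V) t) - k / t * deriv V t = F (V t))
    (hE : memE k (deriv V)) : ModeSol k k (fun t => deriv F (V t)) (deriv V) := by
  have hne : ∀ t ∈ Ioi (0 : ℝ), t ≠ 0 := fun t ht => (mem_Ioi.1 ht).ne'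
  have heq : ∀ t ∈ Ioi (0 : ℝ), deriv (deriv V) t = -(k / t * deriv V t) - F (V t) :=
    fun t ht => by linarith [hode t ht]
  have hV1 : ContDiffOn ℝ 1 V (Ioi 0) := hV.of_le one_le_two
  have hc : ContDiffOn ℝ 1 (deriv (deriv V)) (Ioi 0) := by
    refine ContDiffOn.congr ?_ heq
    exact ((contDiffOn_const.div contDiffOn_id hne).mul hE.1).neg.sub (hF.comp_contDiffOn hV1)
  refine ⟨?_, hE, fun t ht => ?_⟩
  · have : ContDiffOn ℝ (1 + 1) (deriv V) (Ioi 0) :=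
      (contDiffOn_succ_iff_deriv_of_isOpen isOpen_Ioi).2
        ⟨hE.1.differentiableOn one_ne_zero, by simp, hc⟩
    exact this.of_le (by norm_num)
  · have h1 : HasDerivAt V (deriv V t) t :=
      ((hV1.differentiableOn one_ne_zero).differentiableAt (Ioi_mem_nhds ht)).hasDerivAt
    have h2 := hE.hasDerivAt ht
    have h3 : HasDerivAt F (deriv F (V t)) (V t) :=
      (hF.differentiable one_ne_zero _).hasDerivAt
    have h4 :=
      ((((hasDerivAt_const t k).fun_div (hasDerivAt_id' t) ht.ne').fun_mul h2).fun_neg).fun_sub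
      (h3.comp t h1)
    have h5 : deriv (deriv V) =ᶠ[𝓝 t] fun t => -(k / t * deriv V t) - (F ∘ V) t :=
      Filter.eventuallyEq_of_mem (Ioi_mem_nhds ht) heq
    rw [h5.deriv_eq, h4.deriv, h5.eq_of_nhds]
    field_simp
    ring

end Profile

section RadialChange

/-- The change of radial variable `r ↦ r ^ (i + 1) / (i + 1)`. -/
noncomputable def powScale (i : ℕ) (r : ℝ) : ℝ := r ^ (i + 1) / (i + 1)

/-- A finite energy solution of the radial form of the linearized problem. -/
def RadialSol (N i : ℕ) (μ : ℝ) (b g : ℝ → ℝ) : Prop :=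
  ContDiffOn ℝ 2 g (Ioi 0) ∧
  (∀ r > 0, deriv (deriv g) r + (N - 1) / r * deriv g r - μ / r ^ 2 * g r = -(b r * g r)) ∧
  IntegrableOn (fun r => r ^ (N - 1) * (r ^ (2 * i) * g r ^ 2)) (Ioi 0) ∧
  IntegrableOn (fun r => r ^ (N - 1) * deriv g r ^ 2) (Ioi 0)

variable {N i : ℕ} {k μ : ℝ} {A f ψ : ℝ → ℝ}

theorem powScale_pos {r : ℝ} (hr : 0 < r) : 0 < powScale i r := by
  unfold powScale
  positivity

theorem hasDerivAt_powScale (r : ℝ) : HasDerivAt (powScale i) (r ^ i) r := by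
  refine ((hasDerivAt_pow (i + 1) r).div_const _).congr_deriv ?_
  rw [Nat.add_sub_cancel]
  push_cast
  field_simp

theorem contDiff_powScale : ContDiff ℝ 2 (powScale i) :=
  (contDiff_id.pow (i + 1)).div_const _

theorem strictMonoOn_powScale : StrictMonoOn (powScale i) (Ioi 0) := by
  intro r hr s hs h
  unfold powScale
  have := pow_lt_pow_left₀ h (mem_Ioi.1 hr).le i.succ_ne_zero
  gcongr

/-- The inverse of `powScale`. -/
noncomputable def rootScale (i : ℕ) (t : ℝ) : ℝ := ((i + 1) * t) ^ ((i + 1 : ℝ)⁻¹)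

theorem rootScale_pos {t : ℝ} (ht : 0 < t) : 0 < rootScale i t := by
  unfold rootScale
  positivity

theorem powScale_rootScale {t : ℝ} (ht : 0 < t) : powScale i (rootScale i t) = t := by
  have h : (0 : ℝ) ≤ (i + 1) * t := by positivity
  have := Real.rpow_inv_natCast_pow h i.succ_ne_zero
  unfold powScale rootScale
  push_cast at this
  rw [this]
  field_simp

theorem rootScale_powScale {r : ℝ} (hr : 0 < r) : rootScale i (powScale i r) = r :=
  strictMonoOn_powScale.injOn (rootScale_pos (powScale_pos hr)) hr
    (powScale_rootScale (powScale_pos hr))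

theorem contDiffOn_rootScale : ContDiffOn ℝ 2 (rootScale i) (Ioi 0) := by
  refine ContDiffOn.rpow_const_of_ne (contDiffOn_const.mul contDiffOn_id) fun t ht => ?_
  have : 0 < t := ht
  positivity

theorem image_powScale : powScale i '' Ioi 0 = Ioi 0 :=
  Subset.antisymm (image_subset_iff.2 fun _ hr => powScale_pos hr)
    fun _ ht => ⟨_, rootScale_pos ht, powScale_rootScale ht⟩

theorem integrableOn_rpow_mul_iff (hN : 1 ≤ N) (hk : k * (i + 1) = N + i - 1) :
    IntegrableOn (fun t => t ^ k * f t) (Ioi 0) ↔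
      IntegrableOn (fun r => r ^ (N - 1) * (r ^ (2 * i) * f (powScale i r))) (Ioi 0) := by
  conv_lhs => rw [← image_powScale (i := i)]
  rw [integrableOn_image_iff_integrableOn_abs_deriv_smul measurableSet_Ioi
    (fun r _ => (hasDerivAt_powScale r).hasDerivWithinAt) strictMonoOn_powScale.injOn]
  have hc : ((i : ℝ) + 1) ^ k ≠ 0 := by positivity
  have heq : ∀ r ∈ Ioi (0 : ℝ), |r ^ i| • (powScale i r ^ k * f (powScale i r)) =
      (((i : ℝ) + 1) ^ k)⁻¹ * (r ^ (N - 1) * (r ^ (2 * i) * f (powScale i r))) := by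
    intro r hr
    have hr : 0 < r := hr
    have h1 : powScale i r ^ k = r ^ (N - 1) * r ^ i / ((i : ℝ) + 1) ^ k := by
      unfold powScale
      rw [Real.div_rpow (by positivity) (by positivity), ← Real.rpow_natCast r (i + 1),
        ← Real.rpow_mul hr.le]
      congr 1
      rw [← pow_add, ← Real.rpow_natCast r]
      congr 1
      push_cast [hN]
      linarith
    rw [h1, abs_of_pos (pow_pos hr i), smul_eq_mul]
    field_simp
    ring
  rw [integrableOn_congr_fun heq measurableSet_Ioi]
  exact integrable_const_mul_iff (IsUnit.mk0 _ (inv_ne_zero hc)) _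

theorem deriv_comp_powScale (hψ : ContDiffOn ℝ 2 ψ (Ioi 0)) {r : ℝ} (hr : 0 < r) :
    deriv (fun r => ψ (powScale i r)) r = deriv ψ (powScale i r) * r ^ i ∧
    deriv (deriv fun r => ψ (powScale i r)) r = deriv (deriv ψ) (powScale i r) * r ^ (2 * i) +
      deriv ψ (powScale i r) * (i / r * r ^ i) := by
  obtain ⟨-, -, h1, h2⟩ := continuousOn_deriv_and_hasDerivAt hψ
  have hd : ∀ r > 0, deriv (fun r => ψ (powScale i r)) r = deriv ψ (powScale i r) * r ^ i :=
    fun r hr => ((h1 _ (powScale_pos hr)).comp r (hasDerivAt_powScale r)).deriv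
  refine ⟨hd r hr, ?_⟩
  have heq : (deriv fun r => ψ (powScale i r)) =ᶠ[𝓝 r] fun r => deriv ψ (powScale i r) * r ^ i :=
    eventuallyEq_of_mem (Ioi_mem_nhds hr) hd
  rw [heq.deriv_eq]
  refine (((h2 _ (powScale_pos hr)).comp r (hasDerivAt_powScale r)).fun_mul
    (hasDerivAt_pow i r)).deriv.trans ?_
  rw [Function.comp_apply]
  cases i with
  | zero => simp
  | succ i =>
    simp only [Nat.add_sub_cancel]
    field_simp
    ring

theorem modeSol_iff_radialSol (hN : 1 ≤ N) (hk : k * (i + 1) = N + i - 1)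
    (hψ : ContDiffOn ℝ 2 ψ (Ioi 0)) :
    ModeSol k (μ / (i + 1) ^ 2) A ψ ↔
      RadialSol N i μ (fun r => r ^ (2 * i) * A (powScale i r)) (fun r => ψ (powScale i r)) := by
  have hψ1 : ContDiffOn ℝ 1 ψ (Ioi 0) := hψ.of_le one_le_two
  have hg : ContDiffOn ℝ 2 (fun r => ψ (powScale i r)) (Ioi 0) :=
    hψ.comp contDiff_powScale.contDiffOn fun r hr => powScale_pos hr
  have hE : memE k ψ ↔ IntegrableOn (fun t => t ^ k * ψ t ^ 2) (Ioi 0) ∧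
      IntegrableOn (fun t => t ^ k * deriv ψ t ^ 2) (Ioi 0) := by
    refine ⟨fun h => ⟨h.integrableOn_sq, h.integrableOn_deriv_sq⟩, fun h => ⟨hψ1, ?_⟩⟩
    refine (h.2.add h.1).congr_fun (fun t _ => ?_) measurableSet_Ioi
    simp only [Pi.add_apply]
    ring
  have hint : IntegrableOn (fun t => t ^ k * deriv ψ t ^ 2) (Ioi 0) ↔
      IntegrableOn (fun r => r ^ (N - 1) * deriv (fun r => ψ (powScale i r)) r ^ 2) (Ioi 0) := by
    rw [integrableOn_rpow_mul_iff hN hk]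
    refine integrableOn_congr_fun (fun r hr => ?_) measurableSet_Ioi
    simp only [(deriv_comp_powScale hψ (mem_Ioi.1 hr)).1]
    ring
  have hode : (∀ t > (0 : ℝ), -(deriv (deriv ψ) t) - k / t * deriv ψ t +
      μ / (i + 1) ^ 2 / t ^ 2 * ψ t = A t * ψ t) ↔
      ∀ r > 0, deriv (deriv fun r => ψ (powScale i r)) r +
        (N - 1) / r * deriv (fun r => ψ (powScale i r)) r - μ / r ^ 2 * ψ (powScale i r) =
        -(r ^ (2 * i) * A (powScale i r) * ψ (powScale i r)) := by
    have hkey : ∀ r > 0, deriv (deriv fun r => ψ (powScale i r)) r +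
        (N - 1) / r * deriv (fun r => ψ (powScale i r)) r - μ / r ^ 2 * ψ (powScale i r) =
        r ^ (2 * i) * (deriv (deriv ψ) (powScale i r) +
          k / powScale i r * deriv ψ (powScale i r) -
          μ / (i + 1) ^ 2 / powScale i r ^ 2 * ψ (powScale i r)) := by
      intro r hr
      have hk' : k = (N + i - 1) / (i + 1) := by
        rw [← hk]
        field_simp
      rw [(deriv_comp_powScale hψ hr).1, (deriv_comp_powScale hψ hr).2, hk']
      generalize deriv (deriv ψ) (powScale i r) = x
      generalize deriv ψ (powScale i r) = y
      generalize ψ (powScale i r) = z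
      simp only [powScale]
      field_simp
      ring
    constructor
    · intro h r hr
      rw [hkey r hr]
      linear_combination (-(r ^ (2 * i))) * h _ (powScale_pos hr)
    · intro h t ht
      have hr := rootScale_pos (i := i) ht
      have := h _ hr
      rw [hkey _ hr, powScale_rootScale ht] at this
      have h2 : rootScale i t ^ (2 * i) ≠ 0 := (pow_pos hr _).ne'
      refine mul_left_cancel₀ h2 ?_
      linear_combination -this
  unfold ModeSol RadialSol
  rw [hE, hode, hint, integrableOn_rpow_mul_iff hN hk]
  tauto

theorem RadialSol.congr {b g h : ℝ → ℝ} (hg : RadialSol N i μ b g) (hgh : ∀ r > 0, h r = g r) :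
    RadialSol N i μ b h := by
  have heq : ∀ r > 0, h =ᶠ[𝓝 r] g := fun r hr => eventuallyEq_of_mem (Ioi_mem_nhds hr) hgh
  have h1 : ∀ r > 0, deriv h r = deriv g r := fun r hr => (heq r hr).deriv_eq
  have h2 : ∀ r > 0, deriv (deriv h) r = deriv (deriv g) r := fun r hr =>
    (heq r hr).deriv.deriv_eq
  refine ⟨hg.1.congr hgh, fun r hr => ?_, ?_, ?_⟩
  · rw [h1 r hr, h2 r hr, hgh r hr, hg.2.1 r hr]
  · refine hg.2.2.1.congr_fun (fun r hr => ?_) measurableSet_Ioi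
    simp only [hgh r hr]
  · refine hg.2.2.2.congr_fun (fun r hr => ?_) measurableSet_Ioi
    simp only [h1 r hr]

theorem RadialSol.exists_modeSol (hN : 1 ≤ N) (hk : k * (i + 1) = N + i - 1) {g : ℝ → ℝ}
    (hg : RadialSol N i μ (fun r => r ^ (2 * i) * A (powScale i r)) g) :
    ∃ ψ, ModeSol k (μ / (i + 1) ^ 2) A ψ ∧ ∀ r > 0, g r = ψ (powScale i r) := by
  have heq : ∀ r > 0, g (rootScale i (powScale i r)) = g r := fun r hr => by
    rw [rootScale_powScale hr]
  refine ⟨fun t => g (rootScale i t), ?_, fun r hr => (heq r hr).symm⟩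
  have hc : ContDiffOn ℝ 2 (fun t => g (rootScale i t)) (Ioi 0) :=
    hg.1.comp contDiffOn_rootScale fun t ht => rootScale_pos ht
  exact (modeSol_iff_radialSol hN hk hc).2 (hg.congr heq)

end RadialChange

section Energy

open MvPolynomial

variable {N i : ℕ}

local notation "𝔼" => EuclideanSpace ℝ (Fin N)

/-- A finite energy solution of `-Δw = b(|x|) w` away from the origin. -/
def EnergySol (N i : ℕ) (b : ℝ → ℝ) (w : EuclideanSpace ℝ (Fin N) → ℝ) : Prop :=
  ContDiffOn ℝ 2 w {x | x ≠ 0} ∧ (∀ x ≠ 0, -(lap w x) = b ‖x‖ * w x) ∧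
  Integrable (fun x => ‖x‖ ^ (2 * i) * w x ^ 2) ∧ Integrable (fun x => ‖fderiv ℝ w x‖ ^ 2)

theorem sq_integral_mul_le {X : Type*} [MeasurableSpace X] {μ : Measure X} {f g : X → ℝ}
    (hf : Integrable (fun x => f x ^ 2) μ) (hg : Integrable (fun x => g x ^ 2) μ)
    (hfg : Integrable (fun x => f x * g x) μ) :
    (∫ x, f x * g x ∂μ) ^ 2 ≤ (1 + ∫ x, g x ^ 2 ∂μ) * ∫ x, f x ^ 2 ∂μ := by
  set I := ∫ x, f x * g x ∂μ
  set a := ∫ x, f x ^ 2 ∂μ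
  set c := ∫ x, g x ^ 2 ∂μ
  have hc : 0 ≤ c := integral_nonneg fun x => sq_nonneg _
  have hsq : 0 ≤ ∫ x, ((1 + c) * f x - I * g x) ^ 2 ∂μ := integral_nonneg fun x => sq_nonneg _
  have hexp : ∫ x, ((1 + c) * f x - I * g x) ^ 2 ∂μ =
      (1 + c) ^ 2 * a - 2 * (1 + c) * I * I + I ^ 2 * c := by
    have h1 := hf.const_mul ((1 + c) ^ 2)
    have h2 := hfg.const_mul (2 * (1 + c) * I)
    have h3 := hg.const_mul (I ^ 2)
    have h12 : Integrable (fun x => (1 + c) ^ 2 * f x ^ 2 - 2 * (1 + c) * I * (f x * g x)) μ :=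
      h1.sub h2
    have hx : ∀ x, ((1 + c) * f x - I * g x) ^ 2 =
        (1 + c) ^ 2 * f x ^ 2 - 2 * (1 + c) * I * (f x * g x) + I ^ 2 * g x ^ 2 := fun x => by ring
    simp only [hx]
    rw [integral_add h12 h3, integral_sub h1 h2, integral_const_mul, integral_const_mul,
      integral_const_mul]
  rw [hexp] at hsq
  have hpos : 0 < 1 + c := by linarith
  nlinarith [sq_nonneg I]

theorem integrableOn_sphereProj_sq [NeZero N] {f : 𝔼 → ℝ} (hf : ContinuousOn f {x | x ≠ 0}) {m : ℕ}
    (hi : Integrable fun x => ‖x‖ ^ m * f x ^ 2) (p : MvPolynomial (Fin N) ℝ) :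
    IntegrableOn (fun r => r ^ (N - 1) * (r ^ m * sphereProj f p r ^ 2)) (Ioi 0) := by
  set c := ∫ θ : Metric.sphere (0 : 𝔼) 1, eval θ.1.ofLp p ^ 2 ∂(volume : Measure 𝔼).toSphere
  refine integrableOn_Ioi_of_abs_le ?_
    ((integrable_and_integral_polar hi).1.const_mul (1 + c)) fun r hr => ?_
  · exact (continuousOn_pow _).mul ((continuousOn_pow _).mul ((continuousOn_sphereProj hf p).pow 2))
  · have hfc := continuous_sphere_smul hf hr
    have hpc := continuous_sphere_eval p
    have hCS := sq_integral_mul_le (integrable_sphere_of_continuous (hfc.pow 2))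
      (integrable_sphere_of_continuous (hpc.pow 2)) (integrable_sphere_of_continuous (hfc.mul hpc))
    have hn : ∀ θ : Metric.sphere (0 : 𝔼) 1, ‖r • θ.1‖ ^ m * f (r • θ.1) ^ 2 =
        r ^ m * f (r • θ.1) ^ 2 := by
      intro θ
      rw [norm_smul, norm_eq_of_mem_sphere θ, mul_one, Real.norm_eq_abs, abs_of_pos hr]
    simp only [hn]
    rw [integral_const_mul, abs_of_nonneg (by positivity)]
    calc _ ≤ r ^ (N - 1) * (r ^ m * ((1 + c) * ∫ θ : Metric.sphere (0 : 𝔼) 1,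
          f (r • θ.1) ^ 2 ∂(volume : Measure 𝔼).toSphere)) := by
          gcongr
          exact hCS
      _ = _ := by ring

theorem abs_fderiv_single_le (f : 𝔼 → ℝ) (x : 𝔼) (j : Fin N) :
    |fderiv ℝ f x (EuclideanSpace.single j 1)| ≤ ‖fderiv ℝ f x‖ := by
  simpa using (fderiv ℝ f x).le_opNorm (EuclideanSpace.single j 1)

theorem integrable_of_continuousOn_compl_zero [NeZero N] {f g : 𝔼 → ℝ}
    (hf : ContinuousOn f {x | x ≠ 0}) (hg : Integrable g) (h : ∀ x ≠ 0, |f x| ≤ g x) :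
    Integrable f := by
  have : Nonempty (Fin N) := ⟨0⟩
  have hr : (volume : Measure 𝔼).restrict {x | x ≠ 0} = volume :=
    Measure.restrict_eq_self_of_ae_mem (Measure.ae_ne volume 0)
  refine hg.mono' ?_ ((Measure.ae_ne volume 0).mono fun x hx => h x hx)
  rw [← hr]
  exact hf.aestronglyMeasurable isOpen_ne.measurableSet

theorem EnergySol.radialSol_sphereProj [NeZero N] {b : ℝ → ℝ} (hb : ContinuousOn b (Ioi 0))
    {w : 𝔼 → ℝ}
    (hw : EnergySol N i b w) {l : ℕ} {p : MvPolynomial (Fin N) ℝ}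
    (hp : p ∈ harmonicSubmodule (Fin N) l) :
    RadialSol N i (l * (l + N - 2)) b (sphereProj w p) := by
  obtain ⟨hw2, hlap, hi1, hi2⟩ := hw
  have hw1 : ContDiffOn ℝ 1 w {x | x ≠ 0} := hw2.of_le one_le_two
  have hfd : ContinuousOn (fderiv ℝ w) {x | x ≠ 0} :=
    hw1.continuousOn_fderiv_of_isOpen isOpen_ne le_rfl
  have hfj : ∀ j, ContinuousOn (fun x => fderiv ℝ w x (EuclideanSpace.single j 1)) {x | x ≠ 0} :=
    fun j => hfd.clm_apply continuousOn_const
  refine ⟨contDiffOn_sphereProj_two hw2 p, fun r hr => sphereProj_ode hw2 hb hlap hp hr,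
    integrableOn_sphereProj_sq hw2.continuousOn hi1 p, ?_⟩
  have hj : ∀ j, IntegrableOn (fun r => r ^ (N - 1) * (r ^ 0 * sphereProj
      (fun x => fderiv ℝ w x (EuclideanSpace.single j 1)) (X j * p) r ^ 2)) (Ioi 0) := by
    intro j
    refine integrableOn_sphereProj_sq (hfj j) ?_ _
    refine integrable_of_continuousOn_compl_zero
      ((continuous_norm.pow 0).continuousOn.mul ((hfj j).pow 2)) hi2 fun x _ => ?_
    rw [pow_zero, one_mul, abs_of_nonneg (sq_nonneg _), ← sq_abs]
    exact pow_le_pow_left₀ (abs_nonneg _) (abs_fderiv_single_le w x j) 2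
  refine integrableOn_Ioi_of_abs_le ((continuousOn_pow _).mul
    (((contDiffOn_sphereProj_one hw1 p).continuousOn_deriv_of_isOpen isOpen_Ioi le_rfl).pow 2))
    ((integrable_finsetSum Finset.univ fun j _ => hj j).const_mul (N : ℝ)) fun r hr => ?_
  rw [(hasDerivAt_sphereProj hw1 p hr).deriv, abs_of_nonneg (by positivity)]
  have := sq_sum_le_card_mul_sum_sq (s := Finset.univ) (f := fun j => sphereProj
      (fun x => fderiv ℝ w x (EuclideanSpace.single j 1)) (X j * p) r)
  rw [Finset.card_univ, Fintype.card_fin] at this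
  simp only [pow_zero, one_mul, ← Finset.mul_sum]
  calc _ ≤ r ^ (N - 1) * _ := mul_le_mul_of_nonneg_left this (by positivity)
    _ = _ := by ring

end Energy

section EnergyRadPoly

open MvPolynomial

variable {N i l : ℕ}

local notation "𝔼" => EuclideanSpace ℝ (Fin N)

theorem norm_fderiv_le_sum (f : 𝔼 → ℝ) (x : 𝔼) :
    ‖fderiv ℝ f x‖ ≤ ∑ j, |fderiv ℝ f x (EuclideanSpace.single j 1)| := by
  refine ContinuousLinearMap.opNorm_le_bound _ (Finset.sum_nonneg fun j _ => abs_nonneg _)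
    fun v => ?_
  rw [fderiv_apply_eq_sum, Real.norm_eq_abs, Finset.sum_mul]
  refine (Finset.abs_sum_le_sum_abs _ _).trans (Finset.sum_le_sum fun j _ => ?_)
  rw [abs_mul, mul_comm]
  exact mul_le_mul_of_nonneg_left (PiLp.norm_apply_le v j) (abs_nonneg _)

theorem exists_abs_eval_pderiv_le {p : MvPolynomial (Fin N) ℝ} (hp : p.IsHomogeneous l)
    (j : Fin N) : ∃ C, 0 ≤ C ∧ ∀ x : 𝔼, x ≠ 0 →
      |eval x.ofLp (pderiv j p)| * ‖x‖ ≤ C * ‖x‖ ^ l := by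
  cases l with
  | zero =>
    refine ⟨0, le_rfl, fun x _ => ?_⟩
    rw [totalDegree_eq_zero_iff_eq_C.1 ((totalDegree_zero_iff_isHomogeneous _).2 hp)]
    simp
  | succ l =>
    obtain ⟨C, hC, h⟩ := IsHomogeneous_abs_eval_le (hp.pderiv (i := j))
    refine ⟨C, hC, fun x hx => ?_⟩
    have := mul_le_mul_of_nonneg_right (h x hx) (norm_nonneg x)
    rwa [Nat.add_sub_cancel, mul_assoc, ← pow_succ] at this

theorem hasDerivAt_inv_pow (l : ℕ) {r : ℝ} (hr : 0 < r) :
    HasDerivAt (fun r : ℝ => (r ^ l)⁻¹) (-(l / r) * (r ^ l)⁻¹) r := by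
  refine ((hasDerivAt_pow l r).fun_inv (pow_pos hr l).ne').congr_deriv ?_
  cases l with
  | zero => simp
  | succ l =>
    simp only [Nat.add_sub_cancel]
    field_simp
    ring

theorem deriv_mul_inv_pow {h : ℝ → ℝ} (hh : ContDiffOn ℝ 2 h (Ioi 0)) (l : ℕ) {r : ℝ} (hr : 0 < r) :
    deriv (fun r => h r * (r ^ l)⁻¹) r = (deriv h r - l / r * h r) * (r ^ l)⁻¹ ∧
    deriv (deriv fun r => h r * (r ^ l)⁻¹) r =
      (deriv (deriv h) r - 2 * l / r * deriv h r + l * (l + 1) / r ^ 2 * h r) * (r ^ l)⁻¹ := by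
  obtain ⟨-, -, h1, h2⟩ := continuousOn_deriv_and_hasDerivAt hh
  have hd : ∀ r > 0, deriv (fun r => h r * (r ^ l)⁻¹) r =
      (deriv h r - l / r * h r) * (r ^ l)⁻¹ := fun r hr => by
    rw [((h1 r hr).fun_mul (hasDerivAt_inv_pow l hr)).deriv]
    ring
  refine ⟨hd r hr, ?_⟩
  have heq : (deriv fun r => h r * (r ^ l)⁻¹) =ᶠ[𝓝 r]
      fun r => (deriv h r - l / r * h r) * (r ^ l)⁻¹ := eventuallyEq_of_mem (Ioi_mem_nhds hr) hd
  rw [heq.deriv_eq, (((h2 r hr).fun_sub (((hasDerivAt_const r (l : ℝ)).fun_div (hasDerivAt_id' r)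
    hr.ne').fun_mul (h1 r hr))).fun_mul (hasDerivAt_inv_pow l hr)).deriv]
  field_simp
  ring

theorem contDiffOn_mul_inv_pow {h : ℝ → ℝ} (hh : ContDiffOn ℝ 2 h (Ioi 0)) (l : ℕ) :
    ContDiffOn ℝ 2 (fun r => h r * (r ^ l)⁻¹) (Ioi 0) :=
  hh.mul ((contDiffOn_id.pow l).inv fun _ hr => pow_ne_zero l (mem_Ioi.1 hr).ne')

theorem exists_norm_fderiv_radPoly_sq_le {h : ℝ → ℝ} (hh : ContDiffOn ℝ 2 h (Ioi 0))
    {p : MvPolynomial (Fin N) ℝ} (hp : p.IsHomogeneous l) :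
    ∃ C, ∀ x : 𝔼, x ≠ 0 → ‖fderiv ℝ (radPoly (fun r => h r * (r ^ l)⁻¹) p) x‖ ^ 2 ≤
      C * (deriv h ‖x‖ ^ 2 + (h ‖x‖ / ‖x‖) ^ 2) := by
  have hj : ∀ j : Fin N, ∃ C, ∀ x : 𝔼, x ≠ 0 →
      |fderiv ℝ (radPoly (fun r => h r * (r ^ l)⁻¹) p) x (EuclideanSpace.single j 1)| ≤
        C * (|deriv h ‖x‖| + |h ‖x‖ / ‖x‖|) := by
    intro j
    obtain ⟨C₁, hC₁, h₁⟩ := IsHomogeneous_abs_eval_le ((isHomogeneous_X ℝ j).mul hp)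
    obtain ⟨C₂, hC₂, h₂⟩ := exists_abs_eval_pderiv_le hp j
    refine ⟨C₁ + C₁ * l + C₂, fun x hx => ?_⟩
    have hr : 0 < ‖x‖ := norm_pos_iff.2 hx
    have hrl : 0 < (‖x‖ ^ l)⁻¹ := inv_pos.2 (pow_pos hr l)
    rw [fderiv_radPoly p hx (((contDiffOn_mul_inv_pow hh l).differentiableOn
      two_ne_zero).differentiableAt (Ioi_mem_nhds hr))]
    simp only [radPoly]
    rw [(deriv_mul_inv_pow hh l hr).1]
    have e1 := h₁ x hx
    have e2 := h₂ x hx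
    generalize eval x.ofLp (X j * p) = P at e1 ⊢
    generalize eval x.ofLp (pderiv j p) = Q at e2 ⊢
    generalize deriv h ‖x‖ = y
    generalize h ‖x‖ = z
    generalize ‖x‖ = r at hr hrl e1 e2 ⊢
    have f1 : |(y - l / r * z) * (r ^ l)⁻¹ / r * P| ≤ C₁ * (|y| + l * |z / r|) := by
      have : |y - l / r * z| ≤ |y| + l * |z / r| := by
        refine (abs_sub _ _).trans_eq ?_
        rw [abs_mul, abs_div, abs_div, Nat.abs_cast]
        ring
      calc |(y - l / r * z) * (r ^ l)⁻¹ / r * P| = |y - l / r * z| * ((r ^ l)⁻¹ / r * |P|) := by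
            rw [abs_mul, abs_div, abs_mul, abs_of_pos hrl, abs_of_pos hr]
            ring
        _ ≤ (|y| + l * |z / r|) * ((r ^ l)⁻¹ / r * (C₁ * r ^ (1 + l))) := by gcongr
        _ = C₁ * (|y| + l * |z / r|) := by
            rw [pow_add, pow_one]
            field_simp
    have f2 : |z * (r ^ l)⁻¹ * Q| ≤ C₂ * |z / r| := by
      calc |z * (r ^ l)⁻¹ * Q| = |z / r| * ((r ^ l)⁻¹ * (|Q| * r)) := by
            rw [abs_mul, abs_mul, abs_div, abs_of_pos hrl, abs_of_pos hr]
            field_simp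
        _ ≤ |z / r| * ((r ^ l)⁻¹ * (C₂ * r ^ l)) := by gcongr
        _ = C₂ * |z / r| := by field_simp
    refine (abs_add_le _ _).trans ((add_le_add f1 f2).trans ?_)
    have g1 : 0 ≤ C₁ * l * |y| := by positivity
    have g2 : 0 ≤ C₂ * |y| := by positivity
    have g3 : 0 ≤ C₁ * |z / r| := by positivity
    linarith
  choose C hC using hj
  refine ⟨2 * (∑ j, C j) ^ 2, fun x hx => ?_⟩
  have h1 := (norm_fderiv_le_sum (radPoly (fun r => h r * (r ^ l)⁻¹) p) x).trans
    (Finset.sum_le_sum fun j _ => hC j x hx)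
  rw [← Finset.sum_mul] at h1
  have h2 := pow_le_pow_left₀ (norm_nonneg _) h1 2
  rw [mul_pow] at h2
  refine h2.trans ?_
  rw [mul_comm 2, mul_assoc]
  refine mul_le_mul_of_nonneg_left ?_ (sq_nonneg _)
  rw [← sq_abs (deriv h ‖x‖), ← sq_abs (h ‖x‖ / ‖x‖)]
  nlinarith [sq_nonneg (|deriv h ‖x‖| - |h ‖x‖ / ‖x‖|)]

theorem ModeSol.energySol_radPoly [NeZero N] {k : ℝ} (hk : 1 < k) (hk' : k * (i + 1) = N + i - 1)
    {A ψ : ℝ → ℝ} (hψ : ModeSol k (l * (l + N - 2) / (i + 1) ^ 2) A ψ)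
    {p : MvPolynomial (Fin N) ℝ} (hp : p ∈ harmonicSubmodule (Fin N) l) :
    EnergySol N i (fun r => r ^ (2 * i) * A (powScale i r))
      (radPoly (fun r => ψ (powScale i r) * (r ^ l)⁻¹) p) := by
  have hN : 1 ≤ N := NeZero.one_le
  have : Nonempty (Fin N) := ⟨0⟩
  have hph : p.IsHomogeneous l := (mem_homogeneousSubmodule _ _).1 hp.1
  have hhardy : IntegrableOn (fun r => r ^ (N - 1) * (ψ (powScale i r) / r) ^ 2) (Ioi 0) := by
    have h1 : IntegrableOn (fun t => t ^ k * (ψ t ^ 2 / t ^ 2)) (Ioi 0) :=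
      (hψ.2.1.hardy hk).congr_fun (fun t _ => by ring) measurableSet_Ioi
    rw [integrableOn_rpow_mul_iff hN hk'] at h1
    refine IntegrableOn.congr_fun (h1.const_mul (1 / ((i : ℝ) + 1) ^ 2)) (fun r hr => ?_)
      measurableSet_Ioi
    have hr : 0 < r := hr
    generalize ψ (powScale i r) = z
    simp only [powScale]
    field_simp
    ring
  obtain ⟨h2, hode, hi1, hi2⟩ := (modeSol_iff_radialSol hN hk' hψ.1).1 hψ
  set h : ℝ → ℝ := fun r => ψ (powScale i r) with hh
  have hg := contDiffOn_mul_inv_pow h2 l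
  have hrad : ∀ {f : ℝ → ℝ}, IntegrableOn (fun r => r ^ (N - 1) * f r) (Ioi 0) →
      Integrable fun x : 𝔼 => f ‖x‖ := by
    intro f hf
    rw [integrable_fun_norm_addHaar]
    simpa using hf
  have hw := contDiffOn_radPoly (n := 2) hg p
  refine ⟨hw, fun x hx => ?_, ?_, ?_⟩
  · have hr : 0 < ‖x‖ := norm_pos_iff.2 hx
    rw [lap_radPoly hg hp hx]
    simp only [radPoly]
    rw [(deriv_mul_inv_pow h2 l hr).1, (deriv_mul_inv_pow h2 l hr).2]
    have := hode _ hr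
    have hb : ‖x‖ ^ (2 * i) * A (powScale i ‖x‖) * h ‖x‖ = -(deriv (deriv h) ‖x‖ +
      (N - 1) / ‖x‖ * deriv h ‖x‖ - l * (l + N - 2) / ‖x‖ ^ 2 * h ‖x‖) := by linarith
    change _ = ‖x‖ ^ (2 * i) * A (powScale i ‖x‖) * (h ‖x‖ * (‖x‖ ^ l)⁻¹ * eval x.ofLp p)
    linear_combination (-((‖x‖ ^ l)⁻¹ * eval x.ofLp p)) * hb
  · obtain ⟨C, -, hC⟩ := IsHomogeneous_abs_eval_le hph
    refine integrable_of_continuousOn_compl_zero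
      ((continuous_norm.pow _).continuousOn.mul (hw.continuousOn.pow 2))
      ((hrad hi1).const_mul (C ^ 2)) fun x hx => ?_
    have hr : 0 < ‖x‖ := norm_pos_iff.2 hx
    rw [abs_of_nonneg (by positivity)]
    have h3 := pow_le_pow_left₀ (abs_nonneg _) (hC x hx) 2
    rw [sq_abs] at h3
    calc ‖x‖ ^ (2 * i) * radPoly (fun r => h r * (r ^ l)⁻¹) p x ^ 2 =
          ‖x‖ ^ (2 * i) * (h ‖x‖ ^ 2 * ((‖x‖ ^ l)⁻¹ ^ 2 * eval x.ofLp p ^ 2)) := by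
          simp only [radPoly]
          ring
      _ ≤ ‖x‖ ^ (2 * i) * (h ‖x‖ ^ 2 * ((‖x‖ ^ l)⁻¹ ^ 2 * (C * ‖x‖ ^ l) ^ 2)) := by gcongr
      _ = _ := by field_simp
  · obtain ⟨C, hC⟩ := exists_norm_fderiv_radPoly_sq_le h2 hph
    have hi : IntegrableOn (fun r => r ^ (N - 1) * (deriv h r ^ 2 + (h r / r) ^ 2)) (Ioi 0) := by
      refine (hi2.add hhardy).congr_fun (fun r _ => ?_) measurableSet_Ioi
      simp only [Pi.add_apply]
      ring
    refine integrable_of_continuousOn_compl_zero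
      (((hw.of_le one_le_two).continuousOn_fderiv_of_isOpen isOpen_ne le_rfl).norm.pow 2)
      ((hrad hi).const_mul C) fun x hx => ?_
    rw [abs_of_nonneg (sq_nonneg _)]
    exact hC x hx

end EnergyRadPoly

section SphereCompleteness

open MvPolynomial

variable {N l : ℕ}

local notation "𝔼" => EuclideanSpace ℝ (Fin N)

theorem eq_zero_of_integral_sphere_sq {f : Metric.sphere (0 : 𝔼) 1 → ℝ} (hf : Continuous f)
    (h : ∫ θ, f θ * f θ ∂(volume : Measure 𝔼).toSphere ≤ 0) : f = 0 := by
  have h0 : 0 ≤ fun θ => f θ * f θ := fun θ => mul_self_nonneg _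
  have := (integral_eq_zero_iff_of_nonneg h0 (integrable_sphere_of_continuous (hf.mul hf))).1
    (h.antisymm (integral_nonneg h0))
  have := (Continuous.ae_eq_iff_eq _ (hf.mul hf) continuous_const).1 this
  funext θ
  exact mul_self_eq_zero.1 (congrFun this θ)

/-- Harmonic polynomials of different degrees are orthogonal on the unit sphere. -/
theorem integral_sphere_harmonic_mul_eq_zero (hN : 3 ≤ N) {m : ℕ} (hml : m ≠ l)
    {q p : MvPolynomial (Fin N) ℝ} (hq : q ∈ harmonicSubmodule (Fin N) m)
    (hp : p ∈ harmonicSubmodule (Fin N) l) :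
    ∫ θ : Metric.sphere (0 : 𝔼) 1, eval θ.1.ofLp q * eval θ.1.ofLp p
      ∂(volume : Measure 𝔼).toSphere = 0 := by
  have : NeZero N := ⟨by lia⟩
  have hqh : q.IsHomogeneous m := (mem_homogeneousSubmodule _ _).1 hq.1
  have hlap : ∀ x : 𝔼, x ≠ 0 → -(lap (radPoly (fun _ => 1) q) x) =
      (fun _ => 0) ‖x‖ * radPoly (fun _ => 1) q x := by
    intro x hx
    rw [lap_radPoly contDiffOn_const hq hx]
    simp [radPoly]
  have h := sphereProj_ode (contDiffOn_radPoly contDiffOn_const q) (b := fun _ => 0)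
    continuousOn_const hlap hp one_pos
  set I := ∫ θ : Metric.sphere (0 : 𝔼) 1, eval θ.1.ofLp q * eval θ.1.ofLp p
      ∂(volume : Measure 𝔼).toSphere
  have hc : sphereProj (radPoly (fun _ => 1) q) p = fun r => r ^ m * I := by
    funext r
    simp only [sphereProj, radPoly, one_mul, IsHomogeneous_eval_smul hqh, mul_assoc]
    exact integral_const_mul _ _
  have hd : deriv (fun r : ℝ => r ^ m * I) = fun r => m * r ^ (m - 1) * I := by
    funext r
    simp
  rw [hc, hd] at h
  simp only [deriv_mul_const_field', deriv_const_mul_field', deriv_pow_field, one_pow, mul_one,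
    div_one, zero_mul, neg_zero, one_mul] at h
  have hcast : (m : ℝ) * ((m - 1 : ℕ) : ℝ) = m * (m - 1) := by
    cases m <;> simp
  rw [hcast] at h
  have hN' : (3 : ℝ) ≤ N := by exact_mod_cast hN
  have hm : (0 : ℝ) ≤ m := m.cast_nonneg
  have hl : (0 : ℝ) ≤ l := l.cast_nonneg
  have hne : (m : ℝ) - l ≠ 0 := sub_ne_zero.2 (by exact_mod_cast hml)
  have hpos : (m : ℝ) + l + N - 2 ≠ 0 := by linarith
  have h0 : ((m : ℝ) - l) * (m + l + N - 2) * I = 0 := by linear_combination h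
  exact (mul_eq_zero.1 h0).resolve_left (mul_ne_zero hne hpos)

theorem eval_sphere_normSq (θ : Metric.sphere (0 : 𝔼) 1) :
    eval θ.1.ofLp (normSq (Fin N)) = 1 := by
  have := EuclideanSpace.norm_sq_eq θ.1
  rw [norm_eq_of_mem_sphere θ] at this
  simp only [Real.norm_eq_abs, sq_abs] at this
  simp [normSq, ← this]

theorem mem_harmonicSubmodule_of_le_one (hl : l ≤ 1) {p : MvPolynomial (Fin N) ℝ}
    (hp : p.IsHomogeneous l) : p ∈ harmonicSubmodule (Fin N) l := by
  refine ⟨hp, LinearMap.mem_ker.2 ?_⟩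
  rw [laplacian_apply]
  refine Finset.sum_eq_zero fun j _ => ?_
  have h := hp.pderiv (i := j)
  rw [Nat.sub_eq_zero_of_le hl] at h
  rw [totalDegree_eq_zero_iff_eq_C.1 ((totalDegree_zero_iff_isHomogeneous _).2 h), pderiv_C]

theorem integral_sphere_mul_eval_eq_zero [NeZero N] {f : Metric.sphere (0 : 𝔼) 1 → ℝ}
    (hf : Continuous f) (h : ∀ l, ∀ p ∈ harmonicSubmodule (Fin N) l,
      ∫ θ, f θ * eval θ.1.ofLp p ∂(volume : Measure 𝔼).toSphere = 0)
    (q : MvPolynomial (Fin N) ℝ) :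
    ∫ θ, f θ * eval θ.1.ofLp q ∂(volume : Measure 𝔼).toSphere = 0 := by
  have hint : ∀ q : MvPolynomial (Fin N) ℝ,
      Integrable (fun θ => f θ * eval θ.1.ofLp q) (volume : Measure 𝔼).toSphere := fun q =>
    integrable_sphere_of_continuous (hf.mul (continuous_sphere_eval q))
  have hhom : ∀ l, ∀ q : MvPolynomial (Fin N) ℝ, q.IsHomogeneous l →
      ∫ θ, f θ * eval θ.1.ofLp q ∂(volume : Measure 𝔼).toSphere = 0 := by
    intro l
    induction l using Nat.strong_induction_on with
    | _ l ih =>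
      intro q hq
      match l, hq, ih with
      | 0, hq, _ => exact h 0 q (mem_harmonicSubmodule_of_le_one zero_le_one hq)
      | 1, hq, _ => exact h 1 q (mem_harmonicSubmodule_of_le_one le_rfl hq)
      | l + 2, hq, ih =>
        obtain ⟨p, hp, s, hs, rfl⟩ := exists_harmonic_add_normSq_mul hq
        simp only [map_add, map_mul, eval_sphere_normSq, one_mul, mul_add]
        rw [integral_add (hint p) (hint s), h _ p hp, ih l (by lia) s hs, add_zero]
  rw [← q.sum_homogeneousComponent]
  simp only [map_sum, Finset.mul_sum]
  rw [integral_finsetSum _ fun l _ => hint _]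
  exact Finset.sum_eq_zero fun l _ => hhom l _ (homogeneousComponent_isHomogeneous l q)

/-- Restrictions of polynomials to the unit sphere, as an algebra homomorphism. -/
noncomputable def sphereEval (N : ℕ) :
    MvPolynomial (Fin N) ℝ →ₐ[ℝ] C(Metric.sphere (0 : EuclideanSpace ℝ (Fin N)) 1, ℝ) :=
  aeval fun j => ⟨fun θ => θ.1.ofLp j, by fun_prop⟩

theorem sphereEval_apply (q : MvPolynomial (Fin N) ℝ) (θ : Metric.sphere (0 : 𝔼) 1) :
    sphereEval N q θ = eval θ.1.ofLp q := by
  induction q using MvPolynomial.induction_on with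
  | C a => simp [sphereEval]
  | add p q hp hq => simp [hp, hq]
  | mul_X p j hp =>
    rw [map_mul, ContinuousMap.mul_apply, hp, map_mul, eval_X]
    simp [sphereEval]

theorem eq_zero_of_integral_sphere_mul_harmonic [NeZero N] {f : Metric.sphere (0 : 𝔼) 1 → ℝ}
    (hf : Continuous f) (h : ∀ l, ∀ p ∈ harmonicSubmodule (Fin N) l,
      ∫ θ, f θ * eval θ.1.ofLp p ∂(volume : Measure 𝔼).toSphere = 0) : f = 0 := by
  have : CompactSpace (Metric.sphere (0 : 𝔼) 1) :=
    isCompact_iff_compactSpace.1 (isCompact_sphere _ _)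
  have hsep : (sphereEval N).range.SeparatesPoints := by
    intro θ η hne
    obtain ⟨j, hj⟩ : ∃ j, θ.1.ofLp j ≠ η.1.ofLp j := by
      by_contra! hall
      exact hne (Subtype.ext (PiLp.ext hall))
    refine ⟨_, ⟨sphereEval N (X j), ⟨X j, rfl⟩, rfl⟩, ?_⟩
    simpa [sphereEval_apply] using hj
  refine eq_zero_of_integral_sphere_sq hf (le_of_forall_pos_le_add fun ε hε => ?_)
  set M := ∫ θ, |f θ| ∂(volume : Measure 𝔼).toSphere
  have hM : 0 ≤ M := integral_nonneg fun θ => abs_nonneg _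
  obtain ⟨⟨_, q, rfl⟩, hq⟩ := ContinuousMap.exists_mem_subalgebra_near_continuous_of_separatesPoints
    (sphereEval N).range hsep f hf (ε / (M + 1)) (by positivity)
  have hq : ∀ θ, |eval θ.1.ofLp q - f θ| < ε / (M + 1) := fun θ => by
    have := hq θ
    rw [Real.norm_eq_abs] at this
    rw [← sphereEval_apply]
    exact this
  have hqc := continuous_sphere_eval q
  have hsub : ∫ θ, f θ * f θ ∂(volume : Measure 𝔼).toSphere =
      ∫ θ, f θ * (f θ - eval θ.1.ofLp q) ∂(volume : Measure 𝔼).toSphere := by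
    simp only [mul_sub]
    have hi : Integrable (fun θ => f θ * eval θ.1.ofLp q) (volume : Measure 𝔼).toSphere :=
      integrable_sphere_of_continuous (hf.mul hqc)
    have hi' : Integrable (fun θ => f θ * f θ) (volume : Measure 𝔼).toSphere :=
      integrable_sphere_of_continuous (hf.mul hf)
    rw [integral_sub hi' hi, integral_sphere_mul_eval_eq_zero hf h q,
      sub_zero]
  rw [hsub, zero_add]
  calc _ ≤ ∫ θ, |f θ| * (ε / (M + 1)) ∂(volume : Measure 𝔼).toSphere := by
        refine integral_mono (integrable_sphere_of_continuous (hf.mul (hf.sub hqc)))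
          (integrable_sphere_of_continuous (hf.abs.mul continuous_const)) fun θ => ?_
        refine (le_abs_self _).trans ?_
        rw [abs_mul, abs_sub_comm (f θ)]
        exact mul_le_mul_of_nonneg_left (hq θ).le (abs_nonneg _)
    _ = M * ε / (M + 1) := by rw [integral_mul_const, mul_div_assoc]
    _ ≤ ε := by
        rw [div_le_iff₀ (by positivity)]
        nlinarith

theorem exists_harmonic_integral_mul_eq [NeZero N] (l : ℕ)
    (c : harmonicSubmodule (Fin N) (l + 1) →ₗ[ℝ] ℝ) :
    ∃ Y ∈ harmonicSubmodule (Fin N) (l + 1), ∀ H : harmonicSubmodule (Fin N) (l + 1),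
      ∫ θ : Metric.sphere (0 : 𝔼) 1, eval θ.1.ofLp Y * eval θ.1.ofLp H.1
        ∂(volume : Measure 𝔼).toSphere = c H := by
  have hint : ∀ p q : MvPolynomial (Fin N) ℝ, Integrable
      (fun θ : Metric.sphere (0 : 𝔼) 1 => eval θ.1.ofLp p * eval θ.1.ofLp q)
      (volume : Measure 𝔼).toSphere := fun p q =>
    integrable_sphere_of_continuous ((continuous_sphere_eval p).mul (continuous_sphere_eval q))
  let B : harmonicSubmodule (Fin N) (l + 1) →ₗ[ℝ]
      Module.Dual ℝ (harmonicSubmodule (Fin N) (l + 1)) := LinearMap.mk₂ ℝ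
    (fun Y H => ∫ θ : Metric.sphere (0 : 𝔼) 1, eval θ.1.ofLp Y.1 * eval θ.1.ofLp H.1
        ∂(volume : Measure 𝔼).toSphere)
    (fun Y Z H => by
      simp only [Submodule.coe_add, map_add, add_mul]
      exact integral_add (hint _ _) (hint _ _))
    (fun a Y H => by
      simp only [Submodule.coe_smul, smul_eval, smul_eq_mul, mul_assoc]
      exact integral_const_mul _ _)
    (fun Y H K => by
      simp only [Submodule.coe_add, map_add, mul_add]
      exact integral_add (hint _ _) (hint _ _))
    (fun a Y H => by
      simp only [Submodule.coe_smul, smul_eval, smul_eq_mul, mul_left_comm _ a]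
      exact integral_const_mul _ _)
  have hB : Function.Injective B := by
    rw [← LinearMap.ker_eq_bot, LinearMap.ker_eq_bot']
    intro Y hY
    have h0 : B Y Y = 0 := by rw [hY, LinearMap.zero_apply]
    have := eq_zero_of_integral_sphere_sq (continuous_sphere_eval Y.1) h0.le
    refine Subtype.ext (eq_zero_of_eval_sphere_eq_zero
      ((mem_homogeneousSubmodule _ _).1 Y.2.1) fun x hx => ?_)
    exact congrFun this ⟨x, by simpa using hx⟩
  obtain ⟨Y, hY⟩ := (LinearMap.injective_iff_surjective_of_finrank_eq_finrank
    Subspace.dual_finrank_eq.symm).1 hB c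
  exact ⟨Y.1, Y.2, fun H => by rw [← hY]; rfl⟩

end SphereCompleteness

section Decomposition

open MvPolynomial

variable {N i : ℕ} {k C : ℝ} {A v : ℝ → ℝ}

local notation "𝔼" => EuclideanSpace ℝ (Fin N)

theorem linODESol_iff_modeSol {ψ : ℝ → ℝ} : LinODESol k A ψ ↔ ModeSol k 0 A ψ := by
  simp [LinODESol, ModeSol]

theorem EnergySol.exists_modeSol [NeZero N] (hk' : k * (i + 1) = N + i - 1)
    (hA : ContinuousOn A (Ioi 0)) {w : 𝔼 → ℝ}
    (hw : EnergySol N i (fun r => r ^ (2 * i) * A (powScale i r)) w) {l : ℕ}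
    {p : MvPolynomial (Fin N) ℝ} (hp : p ∈ harmonicSubmodule (Fin N) l) :
    ∃ φ, ModeSol k (l * (l + N - 2) / (i + 1) ^ 2) A φ ∧
      ∀ r > 0, sphereProj w p r = φ (powScale i r) := by
  have hb : ContinuousOn (fun r => r ^ (2 * i) * A (powScale i r)) (Ioi 0) :=
    (continuousOn_pow _).mul (hA.comp (contDiff_powScale (i := i)).continuous.continuousOn
      fun r hr => powScale_pos hr)
  exact (hw.radialSol_sphereProj hb hp).exists_modeSol NeZero.one_le hk'

/-- Every finite energy solution is the sum of a radial solution and of a solution supported on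
the spherical harmonics of degree `i + 1`. -/
theorem EnergySol.exists_eq_add (hN : 3 ≤ N) (hk : 1 < k) (hk' : k * (i + 1) = N + i - 1)
    (hA : ContinuousOn A (Ioi 0)) (hAC : ∀ t > 0, |A t| ≤ C) (hm : MorseIndexOne k A)
    (hv : ModeSol k k A v) {s : ℝ} (hs : 0 < s) (hvs : v s ≠ 0) {w : 𝔼 → ℝ}
    (hw : EnergySol N i (fun r => r ^ (2 * i) * A (powScale i r)) w) :
    ∃ ψ, LinODESol k A ψ ∧ ∃ Y ∈ harmonicSubmodule (Fin N) (i + 1), ∀ x ≠ 0,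
      w x = ψ (powScale i ‖x‖) +
        radPoly (fun r => v (powScale i r) * (r ^ (i + 1))⁻¹) Y x := by
  have : NeZero N := ⟨by lia⟩
  have hN' : (3 : ℝ) ≤ N := by exact_mod_cast hN
  have hwc : ContinuousOn w {x | x ≠ 0} := hw.1.continuousOn
  have hk0 : 0 < k := one_pos.trans hk
  have hmode : ∀ l, 0 < l → ∀ p ∈ harmonicSubmodule (Fin N) l, ∃ c : ℝ,
      (∀ r > 0, sphereProj w p r = c * v (powScale i r)) ∧ (l ≠ i + 1 → c = 0) := by
    intro l hl p hp
    have hl' : (0 : ℝ) < l := by exact_mod_cast hl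
    obtain ⟨φ, hφ, hφw⟩ := hw.exists_modeSol hk' hA hp
    have hμ : (0 : ℝ) < l * (l + N - 2) / (i + 1) ^ 2 := by
      have : (0 : ℝ) < l + N - 2 := by linarith
      positivity
    obtain ⟨c, hc, hc0⟩ := hφ.eq_const_mul hk hA hAC hm hμ hk0 hv hs hvs
    refine ⟨c, fun r hr => by rw [hφw r hr, hc _ (powScale_pos hr)], fun hne => hc0 fun h => ?_⟩
    rw [div_eq_iff (by positivity)] at h
    have h2 : ((l : ℝ) - (i + 1)) * (l + i + N - 1) = 0 := by linear_combination h + (i + 1) * hk'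
    have hi : (0 : ℝ) ≤ i := i.cast_nonneg
    rcases mul_eq_zero.1 h2 with h3 | h3
    · exact hne (by exact_mod_cast sub_eq_zero.1 h3)
    · linarith
  let c : harmonicSubmodule (Fin N) (i + 1) →ₗ[ℝ] ℝ :=
    { toFun := fun H => (v s)⁻¹ * sphereProj w H.1 (rootScale i s)
      map_add' := fun H K => by
        rw [Submodule.coe_add, sphereProj_add hwc _ _ (rootScale_pos hs), mul_add]
      map_smul' := fun a H => by
        rw [Submodule.coe_smul, sphereProj_smul, RingHom.id_apply, smul_eq_mul, mul_left_comm] }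
  have hc : ∀ H : harmonicSubmodule (Fin N) (i + 1), ∀ r > 0,
      sphereProj w H.1 r = c H * v (powScale i r) := by
    intro H r hr
    obtain ⟨a, ha, -⟩ := hmode (i + 1) i.succ_pos H.1 H.2
    have : c H = a := by
      change (v s)⁻¹ * sphereProj w H.1 (rootScale i s) = a
      rw [ha _ (rootScale_pos hs), powScale_rootScale hs]
      field_simp
    rw [this, ha r hr]
  obtain ⟨Y, hY, hYc⟩ := exists_harmonic_integral_mul_eq i c
  have hYh : Y.IsHomogeneous (i + 1) := (mem_homogeneousSubmodule _ _).1 hY.1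
  set σ := ∫ _ : Metric.sphere (0 : 𝔼) 1, (1 : ℝ) ∂(volume : Measure 𝔼).toSphere with hσ
  have hσ0 : σ ≠ 0 := by
    intro h
    have h1 := eq_zero_of_integral_sphere_sq (N := N) (f := fun _ => 1) continuous_const
      (by simpa only [mul_one] using h.le)
    exact one_ne_zero (congrFun h1 ⟨EuclideanSpace.single 0 1, by simp⟩)
  have hconst : ∀ a : ℝ, (MvPolynomial.C a : MvPolynomial (Fin N) ℝ) ∈
      harmonicSubmodule (Fin N) 0 := fun a =>
    mem_harmonicSubmodule_of_le_one zero_le_one (isHomogeneous_C _ a)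
  obtain ⟨ψ, hψ, hψw⟩ := hw.exists_modeSol hk' hA (hconst σ⁻¹)
  refine ⟨ψ, linODESol_iff_modeSol.2 (by simpa using hψ), Y, hY, fun x hx => ?_⟩
  have hr : 0 < ‖x‖ := norm_pos_iff.2 hx
  set r := ‖x‖ with hrx
  set f : Metric.sphere (0 : 𝔼) 1 → ℝ := fun θ =>
    w (r • θ.1) - ψ (powScale i r) - v (powScale i r) * eval θ.1.ofLp Y with hf
  have hwr := continuous_sphere_smul hwc hr
  have hYr := continuous_sphere_eval Y
  have hfc : Continuous f := (hwr.sub continuous_const).sub (continuous_const.mul hYr)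
  have hfp : ∀ p : MvPolynomial (Fin N) ℝ,
      ∫ θ, f θ * eval θ.1.ofLp p ∂(volume : Measure 𝔼).toSphere = sphereProj w p r -
        ψ (powScale i r) * (∫ θ : Metric.sphere (0 : 𝔼) 1, eval θ.1.ofLp p
          ∂(volume : Measure 𝔼).toSphere) -
        v (powScale i r) * ∫ θ : Metric.sphere (0 : 𝔼) 1, eval θ.1.ofLp Y * eval θ.1.ofLp p
          ∂(volume : Measure 𝔼).toSphere := by
    intro p
    have hp := continuous_sphere_eval p
    have i1 : Integrable (fun θ : Metric.sphere (0 : 𝔼) 1 => w (r • θ.1) * eval θ.1.ofLp p)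
        (volume : Measure 𝔼).toSphere := integrable_sphere_of_continuous (hwr.mul hp)
    have i2 : Integrable (fun θ : Metric.sphere (0 : 𝔼) 1 => ψ (powScale i r) * eval θ.1.ofLp p)
        (volume : Measure 𝔼).toSphere := integrable_sphere_of_continuous (continuous_const.mul hp)
    have i3 : Integrable (fun θ : Metric.sphere (0 : 𝔼) 1 =>
        v (powScale i r) * (eval θ.1.ofLp Y * eval θ.1.ofLp p)) (volume : Measure 𝔼).toSphere :=
      integrable_sphere_of_continuous (continuous_const.mul (hYr.mul hp))
    have i12 : Integrable (fun θ : Metric.sphere (0 : 𝔼) 1 => w (r • θ.1) * eval θ.1.ofLp p -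
        ψ (powScale i r) * eval θ.1.ofLp p) (volume : Measure 𝔼).toSphere := i1.sub i2
    simp only [hf, sub_mul, mul_assoc]
    rw [integral_sub i12 i3, integral_sub i1 i2, integral_const_mul, integral_const_mul]
    rfl
  have hf0 : f = 0 := by
    refine eq_zero_of_integral_sphere_mul_harmonic hfc fun l p hp => ?_
    rw [hfp p]
    rcases Nat.eq_zero_or_pos l with rfl | hl
    · obtain ⟨a, rfl⟩ : ∃ a, p = MvPolynomial.C a :=
        ⟨_, totalDegree_eq_zero_iff_eq_C.1 ((totalDegree_zero_iff_isHomogeneous _).2 hp.1)⟩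
      have hint : ∫ θ : Metric.sphere (0 : 𝔼) 1, eval θ.1.ofLp (MvPolynomial.C a)
          ∂(volume : Measure 𝔼).toSphere = a * σ := by
        rw [hσ, ← integral_const_mul]
        simp only [eval_C, mul_one]
      have hproj : sphereProj w (MvPolynomial.C a) r =
          a * σ * sphereProj w (MvPolynomial.C σ⁻¹) r := by
        rw [mul_assoc, ← sphereProj_smul, ← sphereProj_smul, smul_eq_C_mul, smul_eq_C_mul,
          ← map_mul, ← map_mul, mul_inv_cancel₀ hσ0, mul_one]
      rw [integral_sphere_harmonic_mul_eq_zero hN i.succ_ne_zero hY hp, hint, hproj, hψw r hr]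
      ring
    · have hint : ∫ θ : Metric.sphere (0 : 𝔼) 1, eval θ.1.ofLp p
          ∂(volume : Measure 𝔼).toSphere = 0 := by
        have := integral_sphere_harmonic_mul_eq_zero hN hl.ne (hconst 1) hp
        simpa using this
      rw [hint, mul_zero, sub_zero]
      by_cases hli : l = i + 1
      · subst hli
        rw [hYc ⟨p, hp⟩, hc ⟨p, hp⟩ r hr]
        ring
      · obtain ⟨a, ha, ha0⟩ := hmode l hl p hp
        rw [ha r hr, ha0 hli, integral_sphere_harmonic_mul_eq_zero hN (Ne.symm hli) hY hp]
        ring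
  have hθ : r • (r⁻¹ • x) = x := by rw [smul_smul, mul_inv_cancel₀ hr.ne', one_smul]
  have := congrFun hf0 ⟨r⁻¹ • x, by
    rw [mem_sphere_zero_iff_norm, norm_smul, norm_inv, Real.norm_eq_abs, abs_of_pos hr, ← hrx,
      inv_mul_cancel₀ hr.ne']⟩
  simp only [hf, hθ, Pi.zero_apply] at this
  rw [IsHomogeneous_eval_smul hYh, inv_pow] at this
  simp only [radPoly, ← hrx]
  linear_combination this

end Decomposition

section Basis

open MvPolynomial

variable {N i : ℕ} {k : ℝ} {A v ψ : ℝ → ℝ}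

local notation "𝔼" => EuclideanSpace ℝ (Fin N)

theorem kk_two_mul (N i : ℕ) : kk N (2 * i) * (i + 1) = N + i - 1 := by
  unfold kk
  field_simp
  ring

theorem one_lt_kk_two_mul (hN : 3 ≤ N) (i : ℕ) : 1 < kk N (2 * i) := by
  have : (3 : ℝ) ≤ N := by exact_mod_cast hN
  rw [kk, one_lt_div (by positivity)]
  linarith

theorem linSolution_two_mul_iff {w : 𝔼 → ℝ} :
    LinSolution N (2 * i) (fun x => A (2 / (2 + 2 * i) * ‖x‖ ^ ((2 + 2 * (i : ℝ)) / 2))) w ↔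
      EnergySol N i (fun r => r ^ (2 * i) * A (powScale i r)) w := by
  have h1 : (2 + 2 * (i : ℝ)) / 2 = ((i + 1 : ℕ) : ℝ) := by
    push_cast
    ring
  have h2 : (2 * (i : ℝ)) = ((2 * i : ℕ) : ℝ) := by push_cast; rfl
  have h3 : ∀ r : ℝ, 2 / (2 + 2 * (i : ℝ)) * r ^ (i + 1) = powScale i r := by
    intro r
    rw [powScale]
    field_simp
    ring
  simp only [LinSolution, EnergySol, h1, Real.rpow_natCast, h3]
  simp only [h2, Real.rpow_natCast]

theorem LinODESol.energySol (hN : 3 ≤ N) (hk : 1 < k) (hk' : k * (i + 1) = N + i - 1)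
    (hψ : LinODESol k A ψ) :
    EnergySol N i (fun r => r ^ (2 * i) * A (powScale i r))
      (fun x : 𝔼 => ψ (powScale i ‖x‖)) := by
  have : NeZero N := ⟨by lia⟩
  have hψ' : ModeSol k (((0 : ℕ) : ℝ) * ((0 : ℕ) + N - 2) / (i + 1) ^ 2) A ψ := by
    simpa using linODESol_iff_modeSol.1 hψ
  have h := hψ'.energySol_radPoly hk hk' (mem_harmonicSubmodule_of_le_one zero_le_one
    (isHomogeneous_C (Fin N) (1 : ℝ)))
  convert h using 1
  ext x
  simp [radPoly]

theorem ModeSol.energySol_translation (hN : 3 ≤ N) (hk : 1 < k) (hk' : k * (i + 1) = N + i - 1)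
    (hv : ModeSol k k A v) {Y : MvPolynomial (Fin N) ℝ}
    (hY : Y ∈ harmonicSubmodule (Fin N) (i + 1)) :
    EnergySol N i (fun r => r ^ (2 * i) * A (powScale i r))
      (radPoly (fun r => v (powScale i r) * (r ^ (i + 1))⁻¹) Y) := by
  have : NeZero N := ⟨by lia⟩
  have hμ : ((i + 1 : ℕ) : ℝ) * ((i + 1 : ℕ) + N - 2) / (i + 1) ^ 2 = k := by
    rw [div_eq_iff (by positivity)]
    push_cast
    linear_combination -(i + 1 : ℝ) * hk'
  rw [← hμ] at hv
  exact hv.energySol_radPoly (hμ ▸ hk) (hμ ▸ hk') hY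

/-- A solution supported on harmonics of degree `i + 1` which is radial has zero angular part. -/
theorem eq_zero_of_radPoly_add_radial_eq_zero (hN : 3 ≤ N) {s : ℝ} (hs : 0 < s) (hvs : v s ≠ 0)
    {Y : MvPolynomial (Fin N) ℝ} (hY : Y ∈ harmonicSubmodule (Fin N) (i + 1))
    (h : ∀ x : 𝔼, x ≠ 0 → ψ (powScale i ‖x‖) +
      radPoly (fun r => v (powScale i r) * (r ^ (i + 1))⁻¹) Y x = 0) : Y = 0 := by
  have hYh : Y.IsHomogeneous (i + 1) := (mem_homogeneousSubmodule _ _).1 hY.1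
  have hr := rootScale_pos (i := i) hs
  have hconst : ∀ θ : Metric.sphere (0 : 𝔼) 1, eval θ.1.ofLp Y = -ψ s / v s := by
    intro θ
    have hθ : ‖θ.1‖ = 1 := mem_sphere_zero_iff_norm.1 θ.2
    have hn : ‖rootScale i s • θ.1‖ = rootScale i s := by
      rw [norm_smul, hθ, mul_one, Real.norm_eq_abs, abs_of_pos hr]
    have h1 := h (rootScale i s • θ.1) (norm_pos_iff.1 (by rwa [hn]))
    rw [radPoly, hn, powScale_rootScale hs, IsHomogeneous_eval_smul hYh, mul_assoc,
      inv_mul_cancel_left₀ (pow_ne_zero _ hr.ne')] at h1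
    rw [eq_div_iff hvs]
    linear_combination h1
  have horth := integral_sphere_harmonic_mul_eq_zero hN i.succ_ne_zero hY
    (mem_harmonicSubmodule_of_le_one zero_le_one (isHomogeneous_C (Fin N) (-ψ s / v s)))
  have hsq := eq_zero_of_integral_sphere_sq (continuous_sphere_eval Y) (by
    simp only [eval_C] at horth
    simp only [hconst] at horth ⊢
    exact horth.le)
  exact eq_zero_of_eval_sphere_eq_zero hYh fun x hx =>
    congrFun hsq ⟨x, mem_sphere_zero_iff_norm.2 hx⟩

theorem radPoly_sum_smul {ι : Type*} (s : Finset ι) (g : ℝ → ℝ) (c : ι → ℝ)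
    (p : ι → MvPolynomial (Fin N) ℝ) (x : 𝔼) :
    radPoly g (∑ m ∈ s, c m • p m) x = ∑ m ∈ s, c m * radPoly g (p m) x := by
  simp only [radPoly, map_sum, smul_eval, Finset.mul_sum]
  exact Finset.sum_congr rfl fun _ _ => by ring

end Basis

theorem stmt6 (N : ℕ) (hN : 3 ≤ N) (α : ℝ) (hα : 0 < α)
    (F : ℝ → ℝ) (hF : ContDiff ℝ 1 F)
    (V : ℝ → ℝ) (hV : ContDiffOn ℝ 2 V (Ioi 0)) (hVpos : ∀ t > (0:ℝ), 0 < V t)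
    (hode : ∀ t > (0:ℝ), -(deriv (deriv V) t) - kk N α / t * deriv V t = F (V t))
    (hV'0 : Tendsto (deriv V) (𝓝[>] 0) (𝓝 0)) (hVinf : Tendsto V atTop (𝓝 0))
    (hmorse : MorseIndexOne (kk N α) (fun t => deriv F (V t)))
    (hV'E : memE (kk N α) (deriv V))
    (hdeg : ∃ ψ : ℝ → ℝ, LinODESol (kk N α) (fun t => deriv F (V t)) ψ ∧
      ∃ t ∈ Ioi (0:ℝ), ψ t ≠ 0)
    (i : ℕ) (hi : 0 < i) (heven : α = 2 * i) :
    ∀ n : ℕ,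
      (∃ ψs : Fin n → ℝ → ℝ,
        (∀ j, LinODESol (kk N α) (fun t => deriv F (V t)) (ψs j)) ∧
        (∀ c : Fin n → ℝ, (∀ t ∈ Ioi (0:ℝ), ∑ j, c j * ψs j t = 0) → c = 0) ∧
        ∀ ψ : ℝ → ℝ, LinODESol (kk N α) (fun t => deriv F (V t)) ψ →
          ∃ c : Fin n → ℝ, ∀ t ∈ Ioi (0:ℝ), ψ t = ∑ j, c j * ψs j t) →
      ∃ b : Fin (n + dimN N i) → EuclideanSpace ℝ (Fin N) → ℝ,
        (∀ j, LinSolution N α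
          (fun x => deriv F (V (2 / (2 + α) * ‖x‖ ^ ((2 + α) / 2)))) (b j)) ∧
        (∀ c : Fin (n + dimN N i) → ℝ,
          (∀ x : EuclideanSpace ℝ (Fin N), x ≠ 0 → ∑ j, c j * b j x = 0) → c = 0) ∧
        ∀ w : EuclideanSpace ℝ (Fin N) → ℝ,
          LinSolution N α (fun x => deriv F (V (2 / (2 + α) * ‖x‖ ^ ((2 + α) / 2)))) w →
          ∃ c : Fin (n + dimN N i) → ℝ, ∀ x : EuclideanSpace ℝ (Fin N), x ≠ 0 →
            w x = ∑ j, c j * b j x := by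
  subst heven
  have hk := one_lt_kk_two_mul hN i
  have hk' := kk_two_mul N i
  simp only [linSolution_two_mul_iff (A := fun t => deriv F (V t))]
  set k := kk N (2 * i)
  set A := fun t => deriv F (V t)
  have hA : ContinuousOn A (Ioi 0) :=
    (hF.continuous_deriv le_rfl).comp_continuousOn hV.continuousOn
  obtain ⟨C, hAC⟩ := exists_abs_deriv_comp_le hF hV hV'0 hVinf
  obtain ⟨s, hs, hvs⟩ := exists_deriv_ne_zero_of_tendsto hV hVpos hVinf
  have hv : ModeSol k k A (deriv V) := modeSol_deriv hF hV hode hV'E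
  rintro n ⟨ψs, hψs, hind, hspan⟩
  let B := Module.finBasisOfFinrankEq ℝ _ (MvPolynomial.finrank_harmonicSubmodule hN hi)
  let g : ℝ → ℝ := fun r => deriv V (powScale i r) * (r ^ (i + 1))⁻¹
  let b : Fin (n + dimN N i) → EuclideanSpace ℝ (Fin N) → ℝ :=
    Fin.append (fun j x => ψs j (powScale i ‖x‖)) (fun m => radPoly g (B m).1)
  have hsum : ∀ (c : Fin (n + dimN N i) → ℝ) x, ∑ j, c j * b j x =
      ∑ j, c (Fin.castAdd _ j) * ψs j (powScale i ‖x‖) +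
        radPoly g (∑ m, c (Fin.natAdd n m) • B m).1 x := by
    intro c x
    simp only [b, Fin.sum_univ_add, Fin.append_left, Fin.append_right, Submodule.coe_sum,
      Submodule.coe_smul, radPoly_sum_smul]
  refine ⟨b, fun j => ?_, fun c hc => ?_, fun w hw => ?_⟩
  · refine Fin.addCases (fun j => ?_) (fun m => ?_) j
    · simpa only [b, Fin.append_left] using (hψs j).energySol hN hk hk'
    · simpa only [b, Fin.append_right] using hv.energySol_translation hN hk hk' (B m).2
  · simp only [hsum] at hc
    have hY : ∑ m, c (Fin.natAdd n m) • B m = 0 := Subtype.ext <|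
      eq_zero_of_radPoly_add_radial_eq_zero hN hs hvs
      (ψ := fun t => ∑ j, c (Fin.castAdd _ j) * ψs j t)
      (∑ m, c (Fin.natAdd n m) • B m).2 hc
    have hcY := Fintype.linearIndependent_iff.1 B.linearIndependent _ hY
    have hcψ := hind (fun j => c (Fin.castAdd _ j)) fun t ht => by
      have : NeZero N := ⟨by lia⟩
      have hr := rootScale_pos (i := i) ht
      have hn : ‖(EuclideanSpace.single 0 (rootScale i t) : EuclideanSpace ℝ (Fin N))‖ =
          rootScale i t := by
        simp [abs_of_pos hr]
      have h := hc _ (norm_pos_iff.1 (hn.symm ▸ hr))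
      rw [hY] at h
      simpa [hn, radPoly, powScale_rootScale ht] using h
    funext j
    exact Fin.addCases (fun j => congrFun hcψ j) hcY j
  · obtain ⟨ψ, hψ, Y, hY, hwY⟩ := hw.exists_eq_add hN hk hk' hA hAC hmorse hv hs hvs
    obtain ⟨c, hc⟩ := hspan ψ hψ
    refine ⟨Fin.append c (B.repr ⟨Y, hY⟩), fun x hx => ?_⟩
    rw [hsum, hwY x hx, hc _ (powScale_pos (norm_pos_iff.2 hx))]
    simp only [Fin.append_left, Fin.append_right, B.sum_repr, g]
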